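/- arXiv:2403.20283 — 2 statements merged into one kernel-verified Lean document; each statement's English description precedes it below -/
import Mathlib

section
/- There is an absolute constant c > 0 such that the following holds. Let S = {p_1 < p_2 < … < p_m} ⊆ [n] with m ≤ t/100, and set the convention that for j = m the memory state M_{(i,p_{m+1}-1)} denotes M_{(i+1,p_1-1)} (the sum wraps to the next pass). Let M be a k-pass streaming algorithm on streams in [t]^n whose memory does not change during its k-th pass, together with an output bit that is a (possibly randomized) function of the final memory state. If Pr[output = 1 when X ∼ D0] + Pr[output = 0 when X ∼ D^S] ≤ 0.1, then Σ_{i=1}^{k-1} Σ_{j=1}^{m} Σ_{ℓ=1}^{j} I(M_{(i,p_{j+1}-1)}; X_{p_ℓ} | M_{(≤i,p_ℓ-1)}, M_{(≤i-1,p_{j+1}-1)}) ≥ c, where X ∼ D0. -/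
open scoped Classical
open Finset

noncomputable section

namespace MultiPassIC

/-- Probability of an event under a probability mass function `p` on a finite sample space. -/
def pr {Ω : Type} [Fintype Ω] (p : Ω → ℝ) (E : Ω → Prop) : ℝ :=
  ∑ ω, if E ω then p ω else 0

/-- `p` is a probability mass function on the finite type `Ω`. -/
structure IsPMF {Ω : Type} [Fintype Ω] (p : Ω → ℝ) : Prop where
  nonneg : ∀ ω, 0 ≤ p ω
  sum_one : ∑ ω, p ω = 1

/-- Shannon entropy (base 2) of the random variable `A` under `p`. -/
def H {Ω : Type} [Fintype Ω] {α : Type} [Fintype α] (p : Ω → ℝ) (A : Ω → α) : ℝ :=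
  -∑ a, pr p (fun ω => A ω = a) * Real.logb 2 (pr p (fun ω => A ω = a))

/-- Conditional mutual information `I(A ; B ∣ C)` (base 2), with the usual conventions
for vanishing probabilities. -/
def condMI {Ω : Type} [Fintype Ω] {α β γ : Type} [Fintype α] [Fintype β] [Fintype γ]
    (p : Ω → ℝ) (A : Ω → α) (B : Ω → β) (C : Ω → γ) : ℝ :=
  ∑ a, ∑ b, ∑ c,
    pr p (fun ω => A ω = a ∧ B ω = b ∧ C ω = c) *
      Real.logb 2 ((pr p (fun ω => C ω = c) *
          pr p (fun ω => A ω = a ∧ B ω = b ∧ C ω = c)) /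
        (pr p (fun ω => A ω = a ∧ C ω = c) * pr p (fun ω => B ω = b ∧ C ω = c)))

/-- Mutual information `I(A ; B)` (base 2). -/
def MI {Ω : Type} [Fintype Ω] {α β : Type} [Fintype α] [Fintype β]
    (p : Ω → ℝ) (A : Ω → α) (B : Ω → β) : ℝ :=
  condMI p A B (fun _ => (0 : Fin 1))

/-- `X 0, …, X (n-1)` (the first `n` stream elements) are mutually independent under `p`,
i.e. they are drawn from a product distribution. -/
def IsProduct {Ω : Type} [Fintype Ω] {𝒳 : Type} (p : Ω → ℝ) (n : ℕ) (X : ℕ → Ω → 𝒳) : Prop :=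
  ∀ x : ℕ → 𝒳,
    pr p (fun ω => ∀ j < n, X j ω = x j) =
      ∏ j ∈ Finset.range n, pr p (fun ω => X j ω = x j)

/-- A `k`-pass streaming algorithm on the input stream `X 0, …, X (n-1)` (0-indexed;
the paper's `X_j` is `X (j-1)`), over a finite sample space `Ω` with pmf `p`.
`S` is the finite set of memory states, `Rv` the value space of the per-step private
randomness, `init` the initial memory state `M₀`, `R i j` the private randomness used at
step `j` of pass `i` (0-indexed), and `f i j` the corresponding transition function.
The field `indep` states that the initial state, all the per-step random seeds, and the
input stream are mutually independent. -/
structure Alg (Ω : Type) [Fintype Ω] (p : Ω → ℝ) (𝒳 : Type) [Fintype 𝒳]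
    (n k : ℕ) (X : ℕ → Ω → 𝒳) where
  S : Type
  fintS : Fintype S
  Rv : Type
  fintR : Fintype Rv
  init : Ω → S
  R : ℕ → ℕ → Ω → Rv
  f : ℕ → ℕ → 𝒳 → S → Rv → S
  indep : ∀ (m : S) (r : ℕ → ℕ → Rv) (x : ℕ → 𝒳),
    pr p (fun ω => init ω = m ∧ (∀ i < k, ∀ j < n, R i j ω = r i j) ∧ (∀ j < n, X j ω = x j))
      = pr p (fun ω => init ω = m)
        * (∏ i ∈ Finset.range k, ∏ j ∈ Finset.range n, pr p (fun ω => R i j ω = r i j))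
        * pr p (fun ω => ∀ j < n, X j ω = x j)

attribute [instance] Alg.fintS Alg.fintR

variable {Ω : Type} [Fintype Ω] {p : Ω → ℝ} {𝒳 : Type} [Fintype 𝒳] {n k : ℕ} {X : ℕ → Ω → 𝒳}

/-- Running pass `i` (0-indexed) of the algorithm for `j` steps starting from `ini`. -/
def Alg.runPass (M : Alg Ω p 𝒳 n k X) (i : ℕ) (ini : Ω → M.S) : ℕ → Ω → M.S
  | 0 => ini
  | j + 1 => fun ω =>
      if j < n ∧ i < k then
        M.f i j (X j ω) (M.runPass i ini j ω) (M.R i j ω)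
      else M.runPass i ini j ω

/-- `M.passEnd i` is the memory state at the end of pass `i`; `M.passEnd 0 = M₀` is the
initial state, and `M.passEnd i` is the paper's `M_i = M_{(i,n)}`. -/
def Alg.passEnd (M : Alg Ω p 𝒳 n k X) : ℕ → Ω → M.S
  | 0 => M.init
  | i + 1 => M.runPass i (M.passEnd i) n

/-- `M.st i j` is the memory state after reading `j` elements in pass `i+1`;
it is the paper's `M_{(i+1, j)}`. -/
def Alg.st (M : Alg Ω p 𝒳 n k X) (i j : ℕ) : Ω → M.S :=
  M.runPass i (M.passEnd i) j

/-- The multi-pass information cost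
`MIC(M, μ) = Σ_{i=1}^{k} Σ_{j=1}^{n} Σ_{ℓ=1}^{j} I(M_{(i,j)}; X_ℓ | M_{(≤i,ℓ-1)}, M_{(≤i-1,j)})
  + Σ_{i=1}^{k} Σ_{j=1}^{n} Σ_{ℓ=j+1}^{n} I(M_{(i,j)}; X_ℓ | M_{(≤i-1,ℓ-1)}, M_{(≤i-1,j)})`
(all summation indices below are 0-indexed shifts of the paper's 1-indexed ones). -/
def Alg.MIC (M : Alg Ω p 𝒳 n k X) : ℝ :=
  (∑ i ∈ Finset.range k, ∑ j ∈ Finset.range n, ∑ l ∈ Finset.range (j + 1),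
    condMI p (M.st i (j + 1)) (X l)
      (fun ω => ((fun r : Fin (i + 1) => M.st r.1 l ω),
                 (fun r : Fin i => M.st r.1 (j + 1) ω))))
  + (∑ i ∈ Finset.range k, ∑ j ∈ Finset.range n, ∑ l ∈ Finset.Ico (j + 1) n,
    condMI p (M.st i (j + 1)) (X l)
      (fun ω => ((fun r : Fin i => M.st r.1 l ω),
                 (fun r : Fin i => M.st r.1 (j + 1) ω))))

/-- The conditional information cost
`MIC_cond(M, μ) = Σ_{j=1}^{n} Σ_{ℓ=1}^{j} I(M_{(≤k,j)}; X_ℓ | M_{<k}, M_{(≤k,ℓ-1)})`. -/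
def Alg.MICcond (M : Alg Ω p 𝒳 n k X) : ℝ :=
  ∑ j ∈ Finset.range n, ∑ l ∈ Finset.range (j + 1),
    condMI p (fun ω => fun r : Fin k => M.st r.1 (j + 1) ω) (X l)
      (fun ω => ((fun r : Fin k => M.passEnd r.1 ω),
                 (fun r : Fin k => M.st r.1 l ω)))

end MultiPassIC

namespace MultiPassIC

/-- The local needle distribution `D^S` as a probability mass function on `[t]^n`, where
`S` is the set of positions `{P 0, …, P (m-1)}`: a needle `α` is drawn uniformly from
`[t]`; coordinates in `S` independently equal `α` with probability `1/2` and are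
otherwise uniform on `[t]`; coordinates outside `S` are uniform on `[t]`. -/
def localNeedlePMF (t n m : ℕ) (P : ℕ → ℕ) (x : Fin n → Fin t) : ℝ :=
  ∑ α : Fin t, (1 / (t : ℝ)) *
    ∏ j : Fin n,
      (if ∃ l < m, P l = j.1 then
        (if x j = α then 1 / 2 + 1 / (2 * (t : ℝ)) else 1 / (2 * (t : ℝ)))
      else 1 / (t : ℝ))

section Probability

variable {Ω : Type} [Fintype Ω] {p : Ω → ℝ}

theorem pr_nonneg (hp : IsPMF p) (E : Ω → Prop) : 0 ≤ pr p E :=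
  Finset.sum_nonneg fun ω _ => by
    split_ifs
    · exact hp.nonneg ω
    · exact le_rfl

theorem pr_pos (hp : IsPMF p) {E : Ω → Prop} {ω : Ω} (hω : 0 < p ω) (hE : E ω) : 0 < pr p E := by
  refine Finset.sum_pos' (fun ω _ => ?_) ⟨ω, Finset.mem_univ ω, by simpa [hE] using hω⟩
  split_ifs
  · exact hp.nonneg ω
  · exact le_rfl

theorem pr_congr {E F : Ω → Prop} (h : ∀ ω, E ω ↔ F ω) : pr p E = pr p F := by
  rw [show E = F from funext fun ω => propext (h ω)]

theorem pr_true (hp : IsPMF p) {E : Ω → Prop} (h : ∀ ω, E ω) : pr p E = 1 := by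
  simp [pr, h, hp.sum_one]

/-- The law of the unconscious statistician. -/
theorem sum_pr_eq_mul {α : Type} [Fintype α] (p : Ω → ℝ) (A : Ω → α) (φ : α → ℝ) :
    ∑ a, pr p (fun ω => A ω = a) * φ a = ∑ ω, p ω * φ (A ω) := by
  simp only [pr, Finset.sum_mul, ite_mul, zero_mul]
  rw [Finset.sum_comm]
  simp

theorem sum_pr_and_eq {α : Type} [Fintype α] (p : Ω → ℝ) (E : Ω → Prop) (A : Ω → α) :
    ∑ a, pr p (fun ω => E ω ∧ A ω = a) = pr p E := by
  simp only [pr]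
  rw [Finset.sum_comm]
  refine Finset.sum_congr rfl fun ω _ => ?_
  by_cases h : E ω <;> simp [h]

theorem sum_mul_congr (hp : IsPMF p) {f g : Ω → ℝ} (h : ∀ ω, 0 < p ω → f ω = g ω) :
    ∑ ω, p ω * f ω = ∑ ω, p ω * g ω := by
  refine Finset.sum_congr rfl fun ω _ => ?_
  rcases (hp.nonneg ω).eq_or_lt with h0 | h0
  · simp [← h0]
  · rw [h ω h0]

theorem sum_mul_le_sum_mul (hp : IsPMF p) {f g : Ω → ℝ} (h : ∀ ω, 0 < p ω → f ω ≤ g ω) :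
    ∑ ω, p ω * f ω ≤ ∑ ω, p ω * g ω := by
  refine Finset.sum_le_sum fun ω _ => ?_
  rcases (hp.nonneg ω).eq_or_lt with h0 | h0
  · simp [← h0]
  · exact mul_le_mul_of_nonneg_left (h ω h0) h0.le

theorem condMI_eq_sum {α β γ : Type} [Fintype α] [Fintype β] [Fintype γ]
    (p : Ω → ℝ) (A : Ω → α) (B : Ω → β) (C : Ω → γ) :
    condMI p A B C = ∑ ω, p ω * Real.logb 2
      ((pr p (fun ω' => C ω' = C ω) * pr p (fun ω' => A ω' = A ω ∧ B ω' = B ω ∧ C ω' = C ω)) /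
        (pr p (fun ω' => A ω' = A ω ∧ C ω' = C ω) * pr p (fun ω' => B ω' = B ω ∧ C ω' = C ω))) := by
  have h := sum_pr_eq_mul p (fun ω => (A ω, B ω, C ω)) (fun s => Real.logb 2
      ((pr p (fun ω' => C ω' = s.2.2) *
          pr p (fun ω' => A ω' = s.1 ∧ B ω' = s.2.1 ∧ C ω' = s.2.2)) /
        (pr p (fun ω' => A ω' = s.1 ∧ C ω' = s.2.2) *
          pr p (fun ω' => B ω' = s.2.1 ∧ C ω' = s.2.2))))
  simp only [Fintype.sum_prod_type, Prod.mk.injEq] at h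
  exact h

theorem condMI_nonneg (hp : IsPMF p) {α β γ : Type} [Fintype α] [Fintype β] [Fintype γ]
    (A : Ω → α) (B : Ω → β) (C : Ω → γ) : 0 ≤ condMI p A B C := by
  have key : ∀ a b c,
      (pr p (fun ω => A ω = a ∧ B ω = b ∧ C ω = c) -
        pr p (fun ω => A ω = a ∧ C ω = c) * pr p (fun ω => B ω = b ∧ C ω = c) /
          pr p (fun ω => C ω = c)) / Real.log 2 ≤
      pr p (fun ω => A ω = a ∧ B ω = b ∧ C ω = c) *
      Real.logb 2 ((pr p (fun ω => C ω = c) *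
          pr p (fun ω => A ω = a ∧ B ω = b ∧ C ω = c)) /
        (pr p (fun ω => A ω = a ∧ C ω = c) * pr p (fun ω => B ω = b ∧ C ω = c))) := by
    intro a b c
    have h2 : 0 < Real.log 2 := Real.log_pos (by norm_num)
    have hac := pr_nonneg hp (fun ω => A ω = a ∧ C ω = c)
    have hbc := pr_nonneg hp (fun ω => B ω = b ∧ C ω = c)
    have hc := pr_nonneg hp (fun ω => C ω = c)
    rcases (pr_nonneg hp (fun ω => A ω = a ∧ B ω = b ∧ C ω = c)).eq_or_lt with h0 | h0
    · rw [← h0, zero_mul, zero_sub]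
      exact div_nonpos_of_nonpos_of_nonneg
        (neg_nonpos.2 (div_nonneg (mul_nonneg hac hbc) hc)) h2.le
    · have hex : ∃ ω, 0 < p ω ∧ A ω = a ∧ B ω = b ∧ C ω = c := by
        obtain ⟨ω, -, hω⟩ := Finset.exists_ne_zero_of_sum_ne_zero h0.ne'
        by_cases hE : A ω = a ∧ B ω = b ∧ C ω = c
        · rw [if_pos hE] at hω
          exact ⟨ω, lt_of_le_of_ne (hp.nonneg ω) (Ne.symm hω), hE⟩
        · rw [if_neg hE] at hω
          exact absurd rfl hω
      obtain ⟨ω, hω, ha, hb, hcω⟩ := hex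
      have hac : 0 < pr p (fun ω => A ω = a ∧ C ω = c) := pr_pos hp hω ⟨ha, hcω⟩
      have hbc : 0 < pr p (fun ω => B ω = b ∧ C ω = c) := pr_pos hp hω ⟨hb, hcω⟩
      have hc : 0 < pr p (fun ω => C ω = c) := pr_pos hp hω hcω
      rw [Real.logb, ← mul_div_assoc]
      refine div_le_div_of_nonneg_right ?_ h2.le
      have h := Real.one_sub_inv_le_log_of_pos (div_pos (mul_pos hc h0) (mul_pos hac hbc))
      refine le_trans (le_of_eq ?_) (mul_le_mul_of_nonneg_left h h0.le)
      field_simp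
  have hsum : ∑ a, ∑ b, ∑ c, (pr p (fun ω => A ω = a ∧ B ω = b ∧ C ω = c) -
        pr p (fun ω => A ω = a ∧ C ω = c) * pr p (fun ω => B ω = b ∧ C ω = c) /
          pr p (fun ω => C ω = c)) / Real.log 2 = 0 := by
    have hz : ∀ c, ∑ a, ∑ b, (pr p (fun ω => A ω = a ∧ B ω = b ∧ C ω = c) -
        pr p (fun ω => A ω = a ∧ C ω = c) * pr p (fun ω => B ω = b ∧ C ω = c) /
          pr p (fun ω => C ω = c)) = 0 := by
      intro c
      have hA : ∑ a, pr p (fun ω => A ω = a ∧ C ω = c) = pr p (fun ω => C ω = c) := by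
        rw [← sum_pr_and_eq p (fun ω => C ω = c) A]
        exact Finset.sum_congr rfl fun a _ => pr_congr fun ω => and_comm
      have hB : ∑ b, pr p (fun ω => B ω = b ∧ C ω = c) = pr p (fun ω => C ω = c) := by
        rw [← sum_pr_and_eq p (fun ω => C ω = c) B]
        exact Finset.sum_congr rfl fun a _ => pr_congr fun ω => and_comm
      have hAB : ∀ a, ∑ b, pr p (fun ω => A ω = a ∧ B ω = b ∧ C ω = c) =
          pr p (fun ω => A ω = a ∧ C ω = c) := by
        intro a
        rw [← sum_pr_and_eq p (fun ω => A ω = a ∧ C ω = c) B]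
        exact Finset.sum_congr rfl fun b _ => pr_congr fun ω => by tauto
      simp_rw [Finset.sum_sub_distrib, hAB, ← Finset.sum_div, ← Finset.mul_sum, hB,
        ← Finset.sum_mul, hA]
      by_cases h0 : pr p (fun ω => C ω = c) = 0
      · simp [h0]
      · field_simp
        ring
    simp_rw [← Finset.sum_div]
    have hcomm : ∀ F : α → β → γ → ℝ, ∑ a, ∑ b, ∑ c, F a b c = ∑ c, ∑ a, ∑ b, F a b c := by
      intro F
      rw [Finset.sum_congr rfl fun a _ => Finset.sum_comm (f := fun b c => F a b c)]
      exact Finset.sum_comm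
    rw [hcomm, Finset.sum_eq_zero fun c _ => hz c, zero_div]
  rw [← hsum]
  exact Finset.sum_le_sum fun a _ => Finset.sum_le_sum fun b _ => Finset.sum_le_sum
    fun c _ => key a b c

end Probability

/-- Functions of disjoint sets of coordinates of a product distribution are uncorrelated. -/
theorem sum_prod_mul_mul {ι κ : Type} [Fintype ι] [DecidableEq ι] [Fintype κ] {W : ι → κ → ℝ}
    (hW : ∀ i, ∑ c, W i c = 1) {F G : (ι → κ) → ℝ} {A B : Set ι} (hAB : Disjoint A B)
    (hF : DependsOn F A) (hG : DependsOn G B) :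
    ∑ c : ι → κ, (∏ i, W i (c i)) * (F c * G c) =
      (∑ c : ι → κ, (∏ i, W i (c i)) * F c) * ∑ c : ι → κ, (∏ i, W i (c i)) * G c := by
  have hone : ∑ c : ι → κ, ∏ i, W i (c i) = 1 := by
    rw [← Fintype.prod_sum]
    simp [hW]
  let mix : (ι → κ) × (ι → κ) → (ι → κ) × (ι → κ) := fun q =>
    (fun i => if i ∈ A then q.1 i else q.2 i, fun i => if i ∈ A then q.2 i else q.1 i)
  have hmix : Function.Involutive mix := by
    rintro ⟨c, d⟩
    simp only [mix, Prod.mk.injEq]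
    constructor <;> funext i <;> by_cases h : i ∈ A <;> simp [h]
  let T : (ι → κ) × (ι → κ) → ℝ := fun q =>
    ((∏ i, W i (q.1 i)) * ∏ i, W i (q.2 i)) * (F q.1 * G q.1)
  have hL : ∑ c : ι → κ, (∏ i, W i (c i)) * (F c * G c) = ∑ q, T q := by
    simp only [T, Fintype.sum_prod_type]
    refine Finset.sum_congr rfl fun c _ => ?_
    rw [← Finset.sum_mul, ← Finset.mul_sum, hone, mul_one]
  rw [hL, ← (Equiv.sum_comp hmix.toPerm T), Finset.sum_mul_sum, Fintype.sum_prod_type]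
  refine Finset.sum_congr rfl fun c _ => Finset.sum_congr rfl fun d _ => ?_
  have hFc : F (mix (c, d)).1 = F c := hF fun i hi => by simp [mix, hi]
  have hGd : G (mix (c, d)).1 = G d := hG fun i hi => by
    simp [mix, Set.disjoint_right.1 hAB hi]
  have hWW : (∏ i, W i ((mix (c, d)).1 i)) * ∏ i, W i ((mix (c, d)).2 i) =
      (∏ i, W i (c i)) * ∏ i, W i (d i) := by
    rw [← Finset.prod_mul_distrib, ← Finset.prod_mul_distrib]
    refine Finset.prod_congr rfl fun i _ => ?_
    by_cases h : i ∈ A <;> simp [mix, h, mul_comm]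
  change ((∏ i, W i ((mix (c, d)).1 i)) * ∏ i, W i ((mix (c, d)).2 i)) *
    (F (mix (c, d)).1 * G (mix (c, d)).1) = _
  rw [hFc, hGd, hWW]
  ring

theorem sum_prod_mul_prod {ι κ τ : Type} [Fintype ι] [DecidableEq ι] [Fintype κ] {W : ι → κ → ℝ}
    (hW : ∀ i, ∑ c, W i c = 1) (s : Finset τ) {F : τ → (ι → κ) → ℝ} {A : τ → Set ι}
    (hA : ∀ a ∈ s, ∀ b ∈ s, a ≠ b → Disjoint (A a) (A b)) (hF : ∀ a ∈ s, DependsOn (F a) (A a)) :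
    ∑ c : ι → κ, (∏ i, W i (c i)) * ∏ a ∈ s, F a c =
      ∏ a ∈ s, ∑ c : ι → κ, (∏ i, W i (c i)) * F a c := by
  induction s using Finset.induction_on with
  | empty =>
    simp only [Finset.prod_empty, mul_one]
    rw [← Fintype.prod_sum]
    simp [hW]
  | insert a s ha ih =>
    simp_rw [Finset.prod_insert ha]
    rw [← ih (fun b hb c hc => hA b (Finset.mem_insert_of_mem hb) c (Finset.mem_insert_of_mem hc))
      (fun b hb => hF b (Finset.mem_insert_of_mem hb))]
    refine sum_prod_mul_mul hW (A := A a) (B := ⋃ b ∈ s, A b) ?_ (hF a (Finset.mem_insert_self a s))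
      ?_
    · simp only [Set.disjoint_iUnion_right]
      intro b hb
      exact hA a (Finset.mem_insert_self a s) b (Finset.mem_insert_of_mem hb)
        (fun h => ha (h ▸ hb))
    · intro c d hcd
      refine Finset.prod_congr rfl fun b hb => hF b (Finset.mem_insert_of_mem hb) fun i hi => ?_
      exact hcd i (Set.mem_biUnion hb hi)

/-- A scalar inequality bounding the relative entropy of a half-diluted likelihood ratio. -/
theorem neg_log_half_add_le {x : ℝ} (hx : 0 ≤ x) :
    -Real.log (1 / 2 + x / 2) ≤ (1 - x) / 2 + (x * Real.log x - x + 1) := by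
  have h1 := Real.one_sub_inv_le_log_of_pos (show 0 < 1 / 2 + x / 2 by positivity)
  have h2 : (√x - 1) ^ 2 ≤ x * Real.log x - x + 1 := by
    rcases hx.eq_or_lt with rfl | hx
    · simp
    have hs : 0 < √x := Real.sqrt_pos.2 hx
    have hsq : √x ^ 2 = x := Real.sq_sqrt hx.le
    have h3 := Real.one_sub_inv_le_log_of_pos hs
    rw [Real.log_sqrt hx.le] at h3
    have h4 := mul_le_mul_of_nonneg_left h3 hx.le
    have h5 : x * (1 - (√x)⁻¹) = x - √x := by
      rw [mul_sub, mul_one, ← div_eq_mul_inv, Real.div_sqrt]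
    rw [h5] at h4
    nlinarith
  have h3 : (1 / 2 + x / 2)⁻¹ - 1 - (1 - x) / 2 ≤ (√x - 1) ^ 2 := by
    have hs : 0 ≤ √x := Real.sqrt_nonneg x
    have hsq : √x ^ 2 = x := Real.sq_sqrt hx
    rw [← hsq, Real.sqrt_sq hs]
    generalize √x = s at hs
    have h4 : (1 / 2 + s ^ 2 / 2)⁻¹ = 2 / (1 + s ^ 2) := by
      field_simp
    rw [h4, sub_sub, sub_le_iff_le_add, div_le_iff₀ (by positivity)]
    nlinarith [mul_nonneg (sq_nonneg (s - 1)) (sq_nonneg (s - 1))]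
  linarith

theorem le_neg_log_of_mem_Icc {L o : ℝ} (hL : 0 < L) (h0 : 0 ≤ o) (h1 : o ≤ 1) :
    (1 - L) + (1 - L) * (1 - o) - 1 / 2 ≤ -Real.log L := by
  rcases le_or_gt 1 L with h | h
  · have := Real.log_le_sub_one_of_pos hL
    nlinarith
  · have hs : 0 < √L := Real.sqrt_pos.2 hL
    have hsq : √L ^ 2 = L := Real.sq_sqrt hL.le
    have h3 := Real.log_le_sub_one_of_pos hs
    rw [Real.log_sqrt hL.le] at h3
    nlinarith [sq_nonneg (2 * √L - 1), mul_nonneg (sub_nonneg.2 h.le) h0]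

section Tilting

variable {Ω L Y : Type} [Fintype Ω] [Fintype L] {t : ℕ} {p : Ω → ℝ}
  {y : Ω → Y} {Z : L → Ω → Fin t} {E : Y → ℝ} {g : L → Y → Fin t → ℝ}

theorem pr_eq_of_factor
    (hfac : ∀ η (x : L → Fin t),
      pr p (fun ω => y ω = η ∧ ∀ l, Z l ω = x l) = E η * ∏ l, g l η (x l)) (η : Y) :
    pr p (fun ω => y ω = η) = E η * ∏ l, ∑ x, g l η x := by
  rw [Fintype.prod_sum, Finset.mul_sum]
  simp_rw [← hfac]
  rw [← sum_pr_and_eq p _ (fun ω l => Z l ω)]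
  simp_rw [funext_iff]

/-- Conditional expectations under a factorized joint law of a transcript and its inputs. -/
theorem sum_mul_prod_eq_of_factor [Fintype Y] (hg : ∀ l η x, 0 ≤ g l η x)
    (hfac : ∀ η (x : L → Fin t),
      pr p (fun ω => y ω = η ∧ ∀ l, Z l ω = x l) = E η * ∏ l, g l η (x l))
    (ψ : L → Fin t → ℝ) (φ : Y → ℝ) :
    ∑ ω, p ω * ((∏ l, ψ l (Z l ω)) * φ (y ω)) =
      ∑ ω, p ω * ((∏ l, (∑ x, ψ l x * g l (y ω) x) / ∑ x, g l (y ω) x) * φ (y ω)) := by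
  have h1 := sum_pr_eq_mul p (fun ω => (y ω, fun l => Z l ω))
    (fun s => (∏ l, ψ l (s.2 l)) * φ s.1)
  have h2 := sum_pr_eq_mul p y
    (fun η => (∏ l, (∑ x, ψ l x * g l η x) / ∑ x, g l η x) * φ η)
  rw [← h1, ← h2, Fintype.sum_prod_type]
  refine Finset.sum_congr rfl fun η _ => ?_
  simp_rw [Prod.mk.injEq, funext_iff, hfac, pr_eq_of_factor hfac]
  have h3 : (∏ l, ∑ x, g l η x) * ∏ l, (∑ x, ψ l x * g l η x) / ∑ x, g l η x =
      ∏ l, ∑ x, ψ l x * g l η x := by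
    rw [← Finset.prod_mul_distrib]
    refine Finset.prod_congr rfl fun l _ => ?_
    by_cases h0 : ∑ x, g l η x = 0
    · have h0' := (Finset.sum_eq_zero_iff_of_nonneg fun x _ => hg l η x).1 h0
      rw [h0, zero_mul, Finset.sum_eq_zero]
      intro x hx
      rw [h0' x hx, mul_zero]
    · field_simp
  have h4 : ∑ x : L → Fin t, (∏ l, ψ l (x l)) * ∏ l, g l η (x l) =
      ∏ l, ∑ x, ψ l x * g l η x := by
    rw [Fintype.prod_sum]
    simp_rw [← Finset.prod_mul_distrib]
  calc _ = ∑ x : L → Fin t, (E η * φ η) * ((∏ l, ψ l (x l)) * ∏ l, g l η (x l)) :=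
        Finset.sum_congr rfl fun x _ => by ring
    _ = (E η * φ η) * ((∏ l, ∑ x, g l η x) *
          ∏ l, (∑ x, ψ l x * g l η x) / ∑ x, g l η x) := by rw [← Finset.mul_sum, h4, h3]
    _ = _ := by ring

theorem sum_pos_of_factor (hp : IsPMF p) (hg : ∀ l η x, 0 ≤ g l η x)
    (hfac : ∀ η (x : L → Fin t),
      pr p (fun ω => y ω = η ∧ ∀ l, Z l ω = x l) = E η * ∏ l, g l η (x l))
    {ω : Ω} (hω : 0 < p ω) (l : L) : 0 < ∑ x, g l (y ω) x := by
  refine lt_of_le_of_ne (Finset.sum_nonneg fun x _ => hg l _ x) fun h0 => ?_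
  have h := pr_pos hp (E := fun ω' => y ω' = y ω) hω rfl
  rw [pr_eq_of_factor hfac, Finset.prod_eq_zero (Finset.mem_univ l) h0.symm, mul_zero] at h
  exact h.false

theorem sum_mul_single_eq_of_factor [Fintype Y] (hp : IsPMF p) (hg : ∀ l η x, 0 ≤ g l η x)
    (hfac : ∀ η (x : L → Fin t),
      pr p (fun ω => y ω = η ∧ ∀ l, Z l ω = x l) = E η * ∏ l, g l η (x l))
    (l : L) (α : Fin t) (φ : Y → ℝ) :
    ∑ ω, p ω * ((if Z l ω = α then (t : ℝ) else 0) * φ (y ω)) =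
      ∑ ω, p ω * (t * g l (y ω) α / (∑ x, g l (y ω) x) * φ (y ω)) := by
  have h := sum_mul_prod_eq_of_factor hg hfac
    (fun l' x => if l' = l then (if x = α then (t : ℝ) else 0) else 1) φ
  have hL : ∀ ω, (∏ l', if l' = l then (if Z l' ω = α then (t : ℝ) else 0) else 1) =
      if Z l ω = α then (t : ℝ) else 0 := fun ω => by
    rw [Finset.prod_ite_eq' Finset.univ l]
    simp
  simp_rw [hL] at h
  rw [h]
  refine sum_mul_congr hp fun ω hω => ?_
  congr 1
  rw [Finset.prod_eq_single l]
  · simp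
  · intro l' _ hl'
    simp [hl', (sum_pos_of_factor hp hg hfac hω l').ne']
  · simp

/-- Distinguishing the uniform distribution from a planted one forces the transcript to reveal
information about the inputs. -/
theorem information_ge_of_distinguishing [Fintype Y] (ht : 0 < t) (hp : IsPMF p) (hg : ∀ l η x, 0 ≤ g l η x)
    (hfac : ∀ η (x : L → Fin t),
      pr p (fun ω => y ω = η ∧ ∀ l, Z l ω = x l) = E η * ∏ l, g l η (x l))
    (hZ : ∀ ψ : L → Fin t → ℝ,
      ∑ ω, p ω * ∏ l, ψ l (Z l ω) = ∏ l, (1 / (t : ℝ) * ∑ x, ψ l x))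
    {o : Y → ℝ} (h0 : ∀ η, 0 ≤ o η) (h1 : ∀ η, o η ≤ 1)
    (herr : ∑ ω, p ω * o (y ω) + 1 / (t : ℝ) * ∑ α : Fin t, ∑ ω, p ω *
      ((∏ l, (1 / 2 + if Z l ω = α then (t : ℝ) / 2 else 0)) * (1 - o (y ω))) ≤ 1 / 5) :
    3 / 10 ≤ ∑ l, ∑ ω, p ω *
      Real.log (t * g l (y ω) (Z l ω) / ∑ x, g l (y ω) x) := by
  have ht' : (0 : ℝ) < t := by exact_mod_cast ht
  set R : L → Fin t → Y → ℝ := fun l α η => t * g l η α / ∑ x, g l η x with hR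
  have hR0 : ∀ l α η, 0 ≤ R l α η := fun l α η =>
    div_nonneg (mul_nonneg ht'.le (hg l η α)) (Finset.sum_nonneg fun x _ => hg l η x)
  have hmean : ∀ l α, ∑ ω, p ω * R l α (y ω) = 1 := by
    intro l α
    have h := sum_mul_single_eq_of_factor hp hg hfac l α (fun _ => 1)
    simp only [mul_one] at h
    rw [← h]
    have h' := hZ (fun l' x => if l' = l then (if x = α then (t : ℝ) else 0) else 1)
    have hL : ∀ ω, (∏ l', if l' = l then (if Z l' ω = α then (t : ℝ) else 0) else 1) =
        if Z l ω = α then (t : ℝ) else 0 := fun ω => by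
      rw [Finset.prod_ite_eq' Finset.univ l]
      simp
    simp_rw [hL] at h'
    rw [h', Finset.prod_eq_single l]
    · simp [ht'.ne']
    · intro l' _ hl'
      simp [hl', ht'.ne']
    · simp
  have htilt : ∀ (α : Fin t) (φ : Y → ℝ),
      ∑ ω, p ω * ((∏ l, (1 / 2 + if Z l ω = α then (t : ℝ) / 2 else 0)) * φ (y ω)) =
        ∑ ω, p ω * ((∏ l, (1 / 2 + R l α (y ω) / 2)) * φ (y ω)) := by
    intro α φ
    rw [sum_mul_prod_eq_of_factor hg hfac (fun _ x => 1 / 2 + if x = α then (t : ℝ) / 2 else 0) φ]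
    refine sum_mul_congr hp fun ω hω => ?_
    congr 1
    refine Finset.prod_congr rfl fun l _ => ?_
    have hpos := sum_pos_of_factor hp hg hfac hω l
    simp only [hR, add_mul, Finset.sum_add_distrib, ← Finset.mul_sum, ite_mul, zero_mul,
      Finset.sum_ite_eq', Finset.mem_univ, if_true]
    field_simp
  have hnorm : ∀ α, ∑ ω, p ω * ∏ l, (1 / 2 + R l α (y ω) / 2) = 1 := by
    intro α
    have h := htilt α (fun _ => 1)
    simp only [mul_one] at h
    rw [← h, hZ (fun _ x => 1 / 2 + if x = α then (t : ℝ) / 2 else 0)]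
    refine Finset.prod_eq_one fun l _ => ?_
    rw [Finset.sum_add_distrib]
    simp
    field_simp
    norm_num
  have hα : ∀ α, 1 / 2 - ∑ ω, p ω * o (y ω) - ∑ ω, p ω *
      ((∏ l, (1 / 2 + if Z l ω = α then (t : ℝ) / 2 else 0)) * (1 - o (y ω))) ≤
      ∑ l, ∑ ω, p ω * (R l α (y ω) * Real.log (R l α (y ω))) := by
    intro α
    have hlow := sum_mul_le_sum_mul hp (f := fun ω => (1 - ∏ l, (1 / 2 + R l α (y ω) / 2)) +
        (1 - ∏ l, (1 / 2 + R l α (y ω) / 2)) * (1 - o (y ω)) - 1 / 2)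
      (g := fun ω => ∑ l, ((1 - R l α (y ω)) / 2 +
        (R l α (y ω) * Real.log (R l α (y ω)) - R l α (y ω) + 1))) (by
        intro ω _
        have hpos : ∀ l, 0 < 1 / 2 + R l α (y ω) / 2 := fun l => by
          have := hR0 l α (y ω)
          positivity
        refine (le_neg_log_of_mem_Icc (Finset.prod_pos fun l _ => hpos l) (h0 _) (h1 _)).trans ?_
        rw [Real.log_prod fun l _ => (hpos l).ne', ← Finset.sum_neg_distrib]
        exact Finset.sum_le_sum fun l _ => neg_log_half_add_le (hR0 l α (y ω)))
    have hl : ∑ ω, p ω * ((1 - ∏ l, (1 / 2 + R l α (y ω) / 2)) +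
        (1 - ∏ l, (1 / 2 + R l α (y ω) / 2)) * (1 - o (y ω)) - 1 / 2) =
        1 / 2 - ∑ ω, p ω * o (y ω) - ∑ ω, p ω *
      ((∏ l, (1 / 2 + if Z l ω = α then (t : ℝ) / 2 else 0)) * (1 - o (y ω))) := by
      rw [htilt α (fun η => 1 - o η)]
      have hsplit : ∀ ω, p ω * ((1 - ∏ l, (1 / 2 + R l α (y ω) / 2)) +
        (1 - ∏ l, (1 / 2 + R l α (y ω) / 2)) * (1 - o (y ω)) - 1 / 2) =
        p ω * (3 / 2) - p ω * (∏ l, (1 / 2 + R l α (y ω) / 2)) - p ω * o (y ω) -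
          p ω * ((∏ l, (1 / 2 + R l α (y ω) / 2)) * (1 - o (y ω))) := fun ω => by ring
      simp_rw [hsplit, Finset.sum_sub_distrib, hnorm, ← Finset.sum_mul, hp.sum_one]
      ring
    have hr : ∑ ω, p ω * ∑ l, ((1 - R l α (y ω)) / 2 +
        (R l α (y ω) * Real.log (R l α (y ω)) - R l α (y ω) + 1)) =
        ∑ l, ∑ ω, p ω * (R l α (y ω) * Real.log (R l α (y ω))) := by
      simp_rw [Finset.mul_sum]
      rw [Finset.sum_comm]
      refine Finset.sum_congr rfl fun l _ => ?_
      have hsplit : ∀ ω, p ω * ((1 - R l α (y ω)) / 2 +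
        (R l α (y ω) * Real.log (R l α (y ω)) - R l α (y ω) + 1)) =
        p ω * (3 / 2) - p ω * R l α (y ω) * (3 / 2) +
          p ω * (R l α (y ω) * Real.log (R l α (y ω))) := fun ω => by ring
      simp_rw [hsplit, Finset.sum_add_distrib, Finset.sum_sub_distrib, ← Finset.sum_mul, hmean,
        hp.sum_one]
      ring
    rw [hl, hr] at hlow
    exact hlow
  have hinfo : ∀ l, ∑ ω, p ω * Real.log (t * g l (y ω) (Z l ω) / ∑ x, g l (y ω) x) =
      1 / (t : ℝ) * ∑ α, ∑ ω, p ω * (R l α (y ω) * Real.log (R l α (y ω))) := by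
    intro l
    have h : ∀ α, ∑ ω, p ω * (R l α (y ω) * Real.log (R l α (y ω))) =
        ∑ ω, p ω * ((if Z l ω = α then (t : ℝ) else 0) * Real.log (R l α (y ω))) := fun α =>
      (sum_mul_single_eq_of_factor hp hg hfac l α (fun η => Real.log (R l α η))).symm
    simp_rw [h]
    rw [Finset.sum_comm, Finset.mul_sum]
    refine Finset.sum_congr rfl fun ω _ => ?_
    simp only [ite_mul, zero_mul, mul_ite, mul_zero, Finset.sum_ite_eq, Finset.mem_univ, if_true]
    simp only [hR]
    field_simp
  simp_rw [hinfo]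
  rw [← Finset.mul_sum, Finset.sum_comm]
  have hsum := Finset.sum_le_sum fun α (_ : α ∈ (Finset.univ : Finset (Fin t))) => hα α
  simp only [Finset.sum_sub_distrib, Finset.sum_const, Finset.card_univ, Fintype.card_fin,
    nsmul_eq_mul] at hsum
  have hfin := mul_le_mul_of_nonneg_left hsum (one_div_nonneg.2 ht'.le)
  refine le_trans ?_ hfin
  have hexp : ∀ a b : ℝ, 1 / (t : ℝ) * (t * (1 / 2) - t * a - b) = 1 / 2 - a - 1 / t * b := by
    intro a b
    field_simp
  rw [hexp]
  linarith

end Tilting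

section Streaming

variable {Ω : Type} [Fintype Ω] {p : Ω → ℝ} {t n k : ℕ} {X : ℕ → Ω → Fin t}

/-- The `j`-th column of an execution: the `j`-th input together with the seeds used at step `j`
of every pass. -/
def Alg.cols (M : Alg Ω p (Fin t) n k X) (ω : Ω) : Fin n → Fin t × (Fin k → M.Rv) :=
  fun j => (X j ω, fun i => M.R i j ω)

/-- The law of the `j`-th column when the input is uniform. -/
def Alg.colWeight (M : Alg Ω p (Fin t) n k X) (j : Fin n) (c : Fin t × (Fin k → M.Rv)) : ℝ :=
  1 / (t : ℝ) * ∏ i : Fin k, pr p (fun ω => M.R i j ω = c.2 i)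

/-- The memory state reached in pass `i` from state `s` by reading the `d` columns `a, …, a+d-1`. -/
def Alg.seg (M : Alg Ω p (Fin t) n k X) (i a : ℕ) :
    ℕ → M.S → (Fin n → Fin t × (Fin k → M.Rv)) → M.S
  | 0, s, _ => s
  | d + 1, s, c =>
    if h : a + d < n ∧ i < k then
      M.f i (a + d) (c ⟨a + d, h.1⟩).1 (M.seg i a d s c) ((c ⟨a + d, h.1⟩).2 ⟨i, h.2⟩)
    else M.seg i a d s c

theorem Alg.seg_congr (M : Alg Ω p (Fin t) n k X) (i a d : ℕ) (s : M.S)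
    {c c' : Fin n → Fin t × (Fin k → M.Rv)}
    (h : ∀ j : Fin n, a ≤ j.1 → j.1 < a + d → c j = c' j) :
    M.seg i a d s c = M.seg i a d s c' := by
  induction d with
  | zero => rfl
  | succ d ih =>
    have ih' := ih fun j h1 h2 => h j h1 (by omega)
    simp only [Alg.seg, ih']
    split_ifs with hd
    · rw [h ⟨a + d, hd.1⟩ (Nat.le_add_right a d) (by simp)]
    · rfl

theorem Alg.st_add (M : Alg Ω p (Fin t) n k X) (i a d : ℕ) (ω : Ω) :
    M.st i (a + d) ω = M.seg i a d (M.st i a ω) (M.cols ω) := by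
  induction d with
  | zero => rfl
  | succ d ih =>
    change (if a + d < n ∧ i < k then
        M.f i (a + d) (X (a + d) ω) (M.st i (a + d) ω) (M.R i (a + d) ω)
      else M.st i (a + d) ω) = _
    rw [ih]
    simp only [Alg.seg, Alg.cols]
    split_ifs <;> rfl

theorem Alg.st_of_le (M : Alg Ω p (Fin t) n k X) (i : ℕ) {a b : ℕ} (hab : a ≤ b) (ω : Ω) :
    M.st i b ω = M.seg i a (b - a) (M.st i a ω) (M.cols ω) := by
  rw [← M.st_add, Nat.add_sub_cancel' hab]

/-- The states at position `a` of each pass, when the state at position `b` of pass `i` is `v i`. -/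
def Alg.outer (M : Alg Ω p (Fin t) n k X) (a b : ℕ) (v : ℕ → M.S) (s : M.S)
    (c : Fin n → Fin t × (Fin k → M.Rv)) : ℕ → M.S
  | 0 => M.seg 0 0 a s c
  | i + 1 => M.seg (i + 1) 0 a (M.seg i b (n - b) (v i) c) c

theorem Alg.outer_congr (M : Alg Ω p (Fin t) n k X) {a b : ℕ} (v : ℕ → M.S) (s : M.S)
    {c c' : Fin n → Fin t × (Fin k → M.Rv)}
    (h : ∀ j : Fin n, j.1 < a ∨ b ≤ j.1 → c j = c' j) (i : ℕ) :
    M.outer a b v s c i = M.outer a b v s c' i := by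
  cases i with
  | zero => exact M.seg_congr _ _ _ _ fun j _ h2 => h j (Or.inl (by omega))
  | succ i =>
    simp only [Alg.outer]
    rw [M.seg_congr i b (n - b) (v i) fun j h1 _ => h j (Or.inr h1)]
    exact M.seg_congr _ _ _ _ fun j _ h2 => h j (Or.inl (by omega))

theorem Alg.st_succ_eq_outer (M : Alg Ω p (Fin t) n k X) {a b : ℕ} (hb : b ≤ n) (v : ℕ → M.S)
    (i : ℕ) (ω : Ω) (h : M.st i b ω = v i) :
    M.st (i + 1) a ω = M.outer a b v (M.init ω) (M.cols ω) (i + 1) := by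
  simp only [Alg.outer]
  rw [← h, ← M.st_add, Nat.add_sub_cancel' hb, M.st_of_le (i + 1) (Nat.zero_le a)]
  rfl

theorem Alg.st_zero_eq_outer (M : Alg Ω p (Fin t) n k X) {a b : ℕ} (v : ℕ → M.S) (ω : Ω) :
    M.st 0 a ω = M.outer a b v (M.init ω) (M.cols ω) 0 :=
  M.st_of_le 0 (Nat.zero_le a) ω

/-- A transcript is produced by an execution iff every block of columns, as well as the columns
outside the blocks, are consistent with it. -/
theorem Alg.transcript_iff (M : Alg Ω p (Fin t) n k X) {P : ℕ → ℕ} {q : ℕ}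
    (hP : ∀ l < q, P l ≤ P (l + 1)) (hn : P q ≤ n) (K : ℕ) (π : ℕ → ℕ → M.S) (ω : Ω) :
    ((∀ i < K, ∀ l ≤ q, M.st i (P l) ω = π i l) ∧ M.st K (P 0) ω = π K 0) ↔
      (∀ i ≤ K, M.outer (P 0) (P q) (fun i => π i q) (M.init ω) (M.cols ω) i = π i 0) ∧
      ∀ l < q, ∀ i < K, M.seg i (P l) (P (l + 1) - P l) (π i l) (M.cols ω) = π i (l + 1) := by
  constructor
  · rintro ⟨h1, h2⟩
    have h0 : ∀ i ≤ K, M.st i (P 0) ω = π i 0 := by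
      intro i hi
      rcases hi.lt_or_eq with hi | rfl
      · exact h1 i hi 0 (Nat.zero_le q)
      · exact h2
    refine ⟨fun i hi => ?_, fun l hl i hi => ?_⟩
    · rw [← h0 i hi]
      cases i with
      | zero => exact (M.st_zero_eq_outer _ ω).symm
      | succ i => exact (M.st_succ_eq_outer hn _ i ω (h1 i hi q le_rfl)).symm
    · rw [← h1 i hi l hl.le, ← h1 i hi (l + 1) hl, ← M.st_of_le i (hP l hl)]
  · rintro ⟨h1, h2⟩
    have hrow : ∀ i < K, M.st i (P 0) ω = π i 0 → ∀ l ≤ q, M.st i (P l) ω = π i l := by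
      intro i hi h0 l
      induction l with
      | zero => exact fun _ => h0
      | succ l ih =>
        intro hl
        rw [M.st_of_le i (hP l hl), ih (by omega)]
        exact h2 l hl i hi
    have hcol : ∀ i ≤ K, M.st i (P 0) ω = π i 0 := by
      intro i
      induction i with
      | zero => exact fun h => (M.st_zero_eq_outer _ ω).trans (h1 0 h)
      | succ i ih =>
        intro hi
        rw [← h1 (i + 1) hi]
        exact M.st_succ_eq_outer hn _ i ω (hrow i hi (ih (by omega)) q le_rfl)
    exact ⟨fun i hi => hrow i hi (hcol i hi.le), hcol K le_rfl⟩

/-- The probability that the columns `a, …, a+d-1` start with input `x` and lead from state `u i`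
to state `v i` in each of the first `K` passes `i`. -/
def Alg.blockWeight (M : Alg Ω p (Fin t) n k X) (K a d : ℕ) (u v : ℕ → M.S) (x : Fin t) : ℝ :=
  ∑ c : Fin n → Fin t × (Fin k → M.Rv), (∏ j, M.colWeight j (c j)) *
    if (∀ j : Fin n, j.1 = a → (c j).1 = x) ∧ ∀ i < K, M.seg i a d (u i) c = v i then 1 else 0

theorem Alg.colWeight_nonneg (M : Alg Ω p (Fin t) n k X) (hp : IsPMF p) (j : Fin n)
    (c : Fin t × (Fin k → M.Rv)) : 0 ≤ M.colWeight j c :=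
  mul_nonneg (by positivity) (Finset.prod_nonneg fun i _ => pr_nonneg hp _)

theorem Alg.sum_colWeight (M : Alg Ω p (Fin t) n k X) (ht : 0 < t) (hp : IsPMF p) (j : Fin n) :
    ∑ c, M.colWeight j c = 1 := by
  have ht' : (t : ℝ) ≠ 0 := by exact_mod_cast ht.ne'
  have h : ∀ i : Fin k, ∑ r, pr p (fun ω => M.R i j ω = r) = 1 := fun i => by
    have := sum_pr_eq_mul p (fun ω => M.R i j ω) (fun _ => 1)
    simpa [hp.sum_one] using this
  simp only [Alg.colWeight, Fintype.sum_prod_type, ← Finset.mul_sum]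
  rw [← Fintype.prod_sum (fun (i : Fin k) r => pr p (fun ω => M.R i j ω = r))]
  simp [h, ht']

theorem Alg.blockWeight_nonneg (M : Alg Ω p (Fin t) n k X) (hp : IsPMF p) (K a d : ℕ)
    (u v : ℕ → M.S) (x : Fin t) : 0 ≤ M.blockWeight K a d u v x :=
  Finset.sum_nonneg fun c _ => mul_nonneg
    (Finset.prod_nonneg fun j _ => M.colWeight_nonneg hp j _) (by split_ifs <;> norm_num)

theorem Alg.blockWeight_congr (M : Alg Ω p (Fin t) n k X) (K a d : ℕ)
    {u v u' v' : ℕ → M.S} (hu : ∀ i < K, u i = u' i) (hv : ∀ i < K, v i = v' i) (x : Fin t) :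
    M.blockWeight K a d u v x = M.blockWeight K a d u' v' x := by
  have h : ∀ c, (∀ i < K, M.seg i a d (u i) c = v i) ↔ ∀ i < K, M.seg i a d (u' i) c = v' i :=
    fun c => forall₂_congr fun i hi => by rw [hu i hi, hv i hi]
  simp only [Alg.blockWeight, h]

/-- The joint law of the initial state and the columns. -/
theorem Alg.pr_init_cols (M : Alg Ω p (Fin t) n k X) (hp : IsPMF p) (ht : 0 < t)
    (hX : ∀ x : Fin n → Fin t,
      pr p (fun ω => ∀ j : Fin n, X j.1 ω = x j) = (1 / (t : ℝ)) ^ n)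
    (s : M.S) (c : Fin n → Fin t × (Fin k → M.Rv)) :
    pr p (fun ω => M.init ω = s ∧ M.cols ω = c) =
      pr p (fun ω => M.init ω = s) * ∏ j, M.colWeight j (c j) := by
  have hΩ : Nonempty Ω := by
    by_contra h
    rw [not_nonempty_iff] at h
    simpa using hp.sum_one
  obtain ⟨ω₀⟩ := hΩ
  have h := M.indep s
    (fun i j => if h : i < k ∧ j < n then (c ⟨j, h.2⟩).2 ⟨i, h.1⟩ else M.R 0 0 ω₀)
    (fun j => if h : j < n then (c ⟨j, h⟩).1 else ⟨0, ht⟩)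
  have hx : pr p (fun ω => ∀ j < n, X j ω = if h : j < n then (c ⟨j, h⟩).1 else ⟨0, ht⟩) =
      (1 / (t : ℝ)) ^ n := by
    rw [← hX fun j => (c j).1]
    refine pr_congr fun ω => ⟨fun h j => ?_, fun h j hj => ?_⟩
    · rw [h j j.2, dif_pos j.2]
    · rw [dif_pos hj]
      exact h ⟨j, hj⟩
  rw [hx] at h
  simp only [Alg.colWeight]
  rw [Finset.prod_mul_distrib, Finset.prod_const, Finset.card_univ, Fintype.card_fin]
  have hR : ∏ i ∈ Finset.range k, ∏ j ∈ Finset.range n, pr p (fun ω => M.R i j ω =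
      if h : i < k ∧ j < n then (c ⟨j, h.2⟩).2 ⟨i, h.1⟩ else M.R 0 0 ω₀) =
      ∏ j : Fin n, ∏ i : Fin k, pr p (fun ω => M.R i j ω = (c j).2 i) := by
    rw [Finset.prod_comm, Finset.prod_range]
    refine Finset.prod_congr rfl fun j _ => ?_
    rw [Finset.prod_range]
    refine Finset.prod_congr rfl fun i _ => ?_
    simp
  rw [hR] at h
  rw [← mul_assoc, mul_right_comm, ← h]
  refine pr_congr fun ω => and_congr_right fun _ => ?_
  constructor
  · rintro rfl
    refine ⟨fun i hi j hj => ?_, fun j hj => ?_⟩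
    · simp [hi, hj, Alg.cols]
    · simp [hj, Alg.cols]
  · rintro ⟨h1, h2⟩
    funext j
    refine Prod.ext ?_ (funext fun i => ?_)
    · have := h2 j j.2
      simpa [Alg.cols] using this
    · have := h1 i i.2 j j.2
      simpa [Alg.cols] using this

theorem Alg.sum_mul_init_cols (M : Alg Ω p (Fin t) n k X) (hp : IsPMF p) (ht : 0 < t)
    (hX : ∀ x : Fin n → Fin t,
      pr p (fun ω => ∀ j : Fin n, X j.1 ω = x j) = (1 / (t : ℝ)) ^ n)
    (φ : M.S → (Fin n → Fin t × (Fin k → M.Rv)) → ℝ) :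
    ∑ ω, p ω * φ (M.init ω) (M.cols ω) =
      ∑ s, pr p (fun ω => M.init ω = s) * ∑ c, (∏ j, M.colWeight j (c j)) * φ s c := by
  have h := sum_pr_eq_mul p (fun ω => (M.init ω, M.cols ω)) (fun z => φ z.1 z.2)
  simp only [Fintype.sum_prod_type, Prod.mk.injEq, M.pr_init_cols hp ht hX] at h
  rw [← h]
  refine Finset.sum_congr rfl fun s _ => ?_
  rw [Finset.mul_sum]
  exact Finset.sum_congr rfl fun c _ => by ring

/-- The rectangle property: the joint law of a transcript and the inputs at the cut positions
factorizes over the blocks. -/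
theorem Alg.exists_transcript_factor (M : Alg Ω p (Fin t) n k X) (hp : IsPMF p) (ht : 0 < t)
    (hX : ∀ x : Fin n → Fin t,
      pr p (fun ω => ∀ j : Fin n, X j.1 ω = x j) = (1 / (t : ℝ)) ^ n)
    {P : ℕ → ℕ} {q : ℕ} (hP : ∀ a b, a < b → b ≤ q → P a < P b) (hPn : P q < n) (K : ℕ) :
    ∃ E : (ℕ → ℕ → M.S) → ℝ, ∀ (π : ℕ → ℕ → M.S) (x : ℕ → Fin t),
      pr p (fun ω => ((∀ i < K, ∀ l ≤ q, M.st i (P l) ω = π i l) ∧ M.st K (P 0) ω = π K 0) ∧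
        ∀ l < q, X (P l) ω = x l) =
      E π * ∏ l ∈ Finset.range q, M.blockWeight K (P l) (P (l + 1) - P l)
        (fun i => π i l) (fun i => π i (l + 1)) (x l) := by
  have hmono : ∀ a b, a ≤ b → b ≤ q → P a ≤ P b := fun a b hab hb => by
    rcases hab.eq_or_lt with rfl | hab
    · exact le_rfl
    · exact (hP a b hab hb).le
  let F : (ℕ → ℕ → M.S) → (ℕ → Fin t) → ℕ → (Fin n → Fin t × (Fin k → M.Rv)) → ℝ :=
    fun π x l c =>
      if (∀ j : Fin n, j.1 = P l → (c j).1 = x l) ∧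
        ∀ i < K, M.seg i (P l) (P (l + 1) - P l) (π i l) c = π i (l + 1) then 1 else 0
  let G : (ℕ → ℕ → M.S) → M.S → (Fin n → Fin t × (Fin k → M.Rv)) → ℝ := fun π s c =>
    if ∀ i ≤ K, M.outer (P 0) (P q) (fun i => π i q) s c i = π i 0 then 1 else 0
  refine ⟨fun π => ∑ s, pr p (fun ω => M.init ω = s) *
    ∑ c, (∏ j, M.colWeight j (c j)) * G π s c, fun π x => ?_⟩
  have hFdep : ∀ l ∈ Finset.range q,
      DependsOn (F π x l) {j : Fin n | P l ≤ j.1 ∧ j.1 < P (l + 1)} := by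
    intro l hl c c' hcc
    have hlt := hP l (l + 1) (Nat.lt_succ_self l) (by simpa using hl)
    have h1 : (∀ j : Fin n, j.1 = P l → (c j).1 = x l) ↔
        ∀ j : Fin n, j.1 = P l → (c' j).1 = x l :=
      forall₂_congr fun j hj => by rw [hcc j ⟨hj.ge, by omega⟩]
    have h2 : ∀ i, M.seg i (P l) (P (l + 1) - P l) (π i l) c =
        M.seg i (P l) (P (l + 1) - P l) (π i l) c' := fun i =>
      M.seg_congr _ _ _ _ fun j hj1 hj2 => hcc j ⟨hj1, by omega⟩
    simp only [F, h1, h2]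
  have hGdep : ∀ s, DependsOn (G π s) {j : Fin n | j.1 < P 0 ∨ P q ≤ j.1} := by
    intro s c c' hcc
    have h1 : ∀ i, M.outer (P 0) (P q) (fun i => π i q) s c i =
        M.outer (P 0) (P q) (fun i => π i q) s c' i := fun i =>
      M.outer_congr _ s (fun j hj => hcc j hj) i
    simp only [G, h1]
  have hdisj : ∀ a ∈ Finset.range q, ∀ b ∈ Finset.range q, a ≠ b →
      Disjoint {j : Fin n | P a ≤ j.1 ∧ j.1 < P (a + 1)}
        {j : Fin n | P b ≤ j.1 ∧ j.1 < P (b + 1)} := by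
    intro a ha b hb hab
    rw [Finset.mem_range] at ha hb
    rw [Set.disjoint_left]
    rintro j ⟨h1, h2⟩ ⟨h3, h4⟩
    rcases hab.lt_or_gt with h | h
    · have := hmono (a + 1) b h hb.le
      omega
    · have := hmono (b + 1) a h ha.le
      omega
  have hdisj' : Disjoint {j : Fin n | j.1 < P 0 ∨ P q ≤ j.1}
      (⋃ l ∈ Finset.range q, {j : Fin n | P l ≤ j.1 ∧ j.1 < P (l + 1)}) := by
    simp only [Set.disjoint_iUnion_right, Finset.mem_range]
    intro l hl
    rw [Set.disjoint_left]
    rintro j h ⟨h3, h4⟩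
    have h5 := hmono 0 l (Nat.zero_le l) hl.le
    have h6 := hmono (l + 1) q hl le_rfl
    rcases h with h | h <;> omega
  have hev : pr p (fun ω => ((∀ i < K, ∀ l ≤ q, M.st i (P l) ω = π i l) ∧
      M.st K (P 0) ω = π K 0) ∧ ∀ l < q, X (P l) ω = x l) =
      ∑ ω, p ω * (G π (M.init ω) (M.cols ω) * ∏ l ∈ Finset.range q, F π x l (M.cols ω)) := by
    refine Finset.sum_congr rfl fun ω _ => ?_
    have hin : (∀ l < q, X (P l) ω = x l) ↔
        ∀ l < q, ∀ j : Fin n, j.1 = P l → (M.cols ω j).1 = x l := by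
      refine forall₂_congr fun l hl => ⟨fun h j hj => ?_, fun h => ?_⟩
      · rw [← h, ← hj]
        rfl
      · exact h ⟨P l, (hmono l q hl.le le_rfl).trans_lt hPn⟩ rfl
    have hFp : ∏ l ∈ Finset.range q, F π x l (M.cols ω) =
        if (∀ l < q, ∀ j : Fin n, j.1 = P l → (M.cols ω j).1 = x l) ∧ (∀ l < q, ∀ i < K,
          M.seg i (P l) (P (l + 1) - P l) (π i l) (M.cols ω) = π i (l + 1)) then 1 else 0 := by
      simp only [F]
      rw [Finset.prod_ite_zero]
      simp only [Finset.mem_range, Finset.prod_const_one]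
      refine if_congr ?_ rfl rfl
      exact ⟨fun h => ⟨fun l hl => (h l hl).1, fun l hl => (h l hl).2⟩,
        fun h l hl => ⟨h.1 l hl, h.2 l hl⟩⟩
    beta_reduce
    rw [hFp, M.transcript_iff (fun l hl => hmono l (l + 1) (Nat.le_succ l) hl) hPn.le, hin]
    simp only [G]
    split_ifs <;> first | (exfalso; tauto) | simp
  rw [hev, M.sum_mul_init_cols hp ht hX
    (fun s c => G π s c * ∏ l ∈ Finset.range q, F π x l c), Finset.sum_mul]
  refine Finset.sum_congr rfl fun s _ => ?_
  rw [sum_prod_mul_mul (M.sum_colWeight ht hp) (F := G π s)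
      (G := fun c => ∏ l ∈ Finset.range q, F π x l c) hdisj' (hGdep s), ← mul_assoc,
    sum_prod_mul_prod (M.sum_colWeight ht hp) (Finset.range q) hdisj hFdep]
  · rfl
  · intro c c' hcc
    exact Finset.prod_congr rfl fun l hl => hFdep l hl fun j hj => hcc j (Set.mem_biUnion hl hj)

theorem Alg.exists_block_factor_le (M : Alg Ω p (Fin t) n k X) (hp : IsPMF p) (ht : 0 < t)
    (hX : ∀ x : Fin n → Fin t,
      pr p (fun ω => ∀ j : Fin n, X j.1 ω = x j) = (1 / (t : ℝ)) ^ n)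
    {a b : ℕ} (hab : a < b) (hb : b < n) (K : ℕ) :
    ∃ E : (ℕ → M.S) → (ℕ → M.S) → ℝ, ∀ (u v : ℕ → M.S) (x : Fin t),
      pr p (fun ω => ((∀ i ≤ K, M.st i a ω = u i) ∧ ∀ i < K, M.st i b ω = v i) ∧ X a ω = x) =
        E u v * M.blockWeight K a (b - a) u v x := by
  obtain ⟨E, hE⟩ := M.exists_transcript_factor hp ht hX
    (P := fun l => if l = 0 then a else b) (q := 1)
    (fun c d hcd hd => by
      obtain rfl : c = 0 := by omega
      obtain rfl : d = 1 := by omega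
      simpa using hab) (by simpa using hb) K
  refine ⟨fun u v => E fun i l => if l = 0 then u i else v i, fun u v x => ?_⟩
  have h := hE (fun i l => if l = 0 then u i else v i) (fun _ => x)
  simp only [Finset.prod_range_one, if_true, Nat.lt_one_iff, forall_eq, zero_add,
    one_ne_zero, if_false] at h
  rw [← h]
  refine pr_congr fun ω => and_congr_left fun _ => ?_
  constructor
  · rintro ⟨h1, h2⟩
    refine ⟨fun i hi l _ => ?_, h1 K le_rfl⟩
    by_cases hl : l = 0
    · simpa [hl] using h1 i hi.le
    · simpa [hl] using h2 i hi
  · rintro ⟨h1, h2⟩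
    refine ⟨fun i hi => ?_, fun i hi => by simpa using h1 i hi 1 le_rfl⟩
    rcases hi.lt_or_eq with hi | rfl
    · simpa using h1 i hi 0 zero_le_one
    · exact h2

theorem Alg.exists_block_factor_lt (M : Alg Ω p (Fin t) n k X) (hp : IsPMF p) (ht : 0 < t)
    (hX : ∀ x : Fin n → Fin t,
      pr p (fun ω => ∀ j : Fin n, X j.1 ω = x j) = (1 / (t : ℝ)) ^ n)
    {a b : ℕ} (hab : a < b) (hb : b < n) (K : ℕ) :
    ∃ E : (ℕ → M.S) → (ℕ → M.S) → ℝ, ∀ (u v : ℕ → M.S) (x : Fin t),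
      pr p (fun ω => ((∀ i < K, M.st i a ω = u i) ∧ ∀ i < K, M.st i b ω = v i) ∧ X a ω = x) =
        E u v * M.blockWeight K a (b - a) u v x := by
  obtain ⟨E, hE⟩ := M.exists_block_factor_le hp ht hX hab hb K
  refine ⟨fun u v => ∑ s, E (Function.update u K s) v, fun u v x => ?_⟩
  rw [← sum_pr_and_eq p _ (M.st K a), Finset.sum_mul]
  refine Finset.sum_congr rfl fun s _ => ?_
  have hu : ∀ i < K, Function.update u K s i = u i := fun i hi =>
    Function.update_of_ne hi.ne _ _
  rw [← M.blockWeight_congr K a (b - a) hu fun _ _ => rfl, ← hE]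
  refine pr_congr fun ω => ?_
  constructor
  · rintro ⟨⟨⟨h1, h2⟩, h3⟩, h4⟩
    refine ⟨⟨fun i hi => ?_, h2⟩, h3⟩
    rcases hi.lt_or_eq with hi | rfl
    · rw [hu i hi, h1 i hi]
    · simpa using h4
  · rintro ⟨⟨h1, h2⟩, h3⟩
    exact ⟨⟨⟨fun i hi => (h1 i hi.le).trans (hu i hi), h2⟩, h3⟩, by simpa using h1 K le_rfl⟩

/-- The probability of the input at position `a` given the states at positions `a` and `b` of the
first `K` passes. -/
def Alg.posterior (M : Alg Ω p (Fin t) n k X) (K a b : ℕ) (ω : Ω) : ℝ :=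
  M.blockWeight K a (b - a) (fun i => M.st i a ω) (fun i => M.st i b ω) (X a ω) /
    ∑ x, M.blockWeight K a (b - a) (fun i => M.st i a ω) (fun i => M.st i b ω) x

theorem pr_and_div_pr_eq_of_factor {C : Ω → Prop} {B : Ω → Fin t} {E : ℝ} {w : Fin t → ℝ}
    (hfac : ∀ x, pr p (fun ω => C ω ∧ B ω = x) = E * w x) (x : Fin t)
    (hpos : 0 < pr p (fun ω => C ω ∧ B ω = x)) :
    pr p (fun ω => C ω ∧ B ω = x) / pr p C = w x / ∑ x, w x := by
  rw [← sum_pr_and_eq p C B]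
  simp_rw [hfac, ← Finset.mul_sum]
  have hE : E ≠ 0 := by
    rintro rfl
    rw [hfac, zero_mul] at hpos
    exact hpos.false
  exact mul_div_mul_left _ _ hE

theorem Alg.condMI_eq_sum_posterior (M : Alg Ω p (Fin t) n k X) (hp : IsPMF p) (ht : 0 < t)
    (hX : ∀ x : Fin n → Fin t,
      pr p (fun ω => ∀ j : Fin n, X j.1 ω = x j) = (1 / (t : ℝ)) ^ n)
    {a b : ℕ} (hab : a < b) (hb : b < n) (i : ℕ) :
    condMI p (M.st i b) (X a)
      (fun ω => ((fun r : Fin (i + 1) => M.st r.1 a ω), (fun r : Fin i => M.st r.1 b ω))) =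
      ∑ ω, p ω * (Real.logb 2 (M.posterior (i + 1) a b ω) -
        Real.logb 2 (M.posterior i a b ω)) := by
  rw [condMI_eq_sum]
  refine sum_mul_congr hp fun ω hω => ?_
  simp only [Prod.mk.injEq, funext_iff, Fin.forall_iff, Nat.lt_succ_iff]
  obtain ⟨E, hE⟩ := M.exists_block_factor_le hp ht hX hab hb i
  obtain ⟨E', hE'⟩ := M.exists_block_factor_lt hp ht hX hab hb (i + 1)
  specialize hE (fun i => M.st i a ω) (fun i => M.st i b ω)
  specialize hE' (fun i => M.st i a ω) (fun i => M.st i b ω)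
  have pBC : 0 < pr p (fun ω' => ((∀ r ≤ i, M.st r a ω' = M.st r a ω) ∧
      ∀ r < i, M.st r b ω' = M.st r b ω) ∧ X a ω' = X a ω) :=
    pr_pos hp hω ⟨⟨fun _ _ => rfl, fun _ _ => rfl⟩, rfl⟩
  have pABC : 0 < pr p (fun ω' => ((∀ r < i + 1, M.st r a ω' = M.st r a ω) ∧
      ∀ r < i + 1, M.st r b ω' = M.st r b ω) ∧ X a ω' = X a ω) :=
    pr_pos hp hω ⟨⟨fun _ _ => rfl, fun _ _ => rfl⟩, rfl⟩
  have pC : 0 < pr p (fun ω' => (∀ r ≤ i, M.st r a ω' = M.st r a ω) ∧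
      ∀ r < i, M.st r b ω' = M.st r b ω) :=
    pr_pos hp hω ⟨fun _ _ => rfl, fun _ _ => rfl⟩
  have pAC : 0 < pr p (fun ω' => (∀ r < i + 1, M.st r a ω' = M.st r a ω) ∧
      ∀ r < i + 1, M.st r b ω' = M.st r b ω) :=
    pr_pos hp hω ⟨fun _ _ => rfl, fun _ _ => rfl⟩
  have hsplit : ∀ ω', (∀ r < i + 1, M.st r b ω' = M.st r b ω) ↔
      M.st i b ω' = M.st i b ω ∧ ∀ r < i, M.st r b ω' = M.st r b ω := fun ω' => by
    rw [Nat.forall_lt_succ_right, and_comm]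
  have eABC : pr p (fun ω' => M.st i b ω' = M.st i b ω ∧ X a ω' = X a ω ∧
      (∀ r ≤ i, M.st r a ω' = M.st r a ω) ∧ ∀ r < i, M.st r b ω' = M.st r b ω) =
      pr p (fun ω' => ((∀ r < i + 1, M.st r a ω' = M.st r a ω) ∧
        ∀ r < i + 1, M.st r b ω' = M.st r b ω) ∧ X a ω' = X a ω) :=
    pr_congr fun ω' => by
      rw [hsplit]
      simp only [Nat.lt_succ_iff]
      tauto
  have eAC : pr p (fun ω' => M.st i b ω' = M.st i b ω ∧
      (∀ r ≤ i, M.st r a ω' = M.st r a ω) ∧ ∀ r < i, M.st r b ω' = M.st r b ω) =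
      pr p (fun ω' => (∀ r < i + 1, M.st r a ω' = M.st r a ω) ∧
        ∀ r < i + 1, M.st r b ω' = M.st r b ω) :=
    pr_congr fun ω' => by
      rw [hsplit]
      simp only [Nat.lt_succ_iff]
      tauto
  have eBC : pr p (fun ω' => X a ω' = X a ω ∧
      (∀ r ≤ i, M.st r a ω' = M.st r a ω) ∧ ∀ r < i, M.st r b ω' = M.st r b ω) =
      pr p (fun ω' => ((∀ r ≤ i, M.st r a ω' = M.st r a ω) ∧
        ∀ r < i, M.st r b ω' = M.st r b ω) ∧ X a ω' = X a ω) :=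
    pr_congr fun ω' => and_comm
  rw [eABC, eAC, eBC, Alg.posterior, Alg.posterior, ← pr_and_div_pr_eq_of_factor hE _ pBC,
    ← pr_and_div_pr_eq_of_factor hE' _ pABC,
    ← Real.logb_div (div_pos pABC pAC).ne' (div_pos pBC pC).ne']
  congr 1
  field_simp

/-- Products of functions of distinct inputs have product expectations. -/
theorem sum_mul_prod_inputs (hX : ∀ x : Fin n → Fin t,
      pr p (fun ω => ∀ j : Fin n, X j.1 ω = x j) = (1 / (t : ℝ)) ^ n) (ht : 0 < t)
    {L : Type} [Fintype L] {e : L → Fin n} (he : Function.Injective e) (ψ : L → Fin t → ℝ) :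
    ∑ ω, p ω * ∏ l, ψ l (X (e l) ω) = ∏ l, (1 / (t : ℝ) * ∑ x, ψ l x) := by
  have ht' : (t : ℝ) ≠ 0 := by exact_mod_cast ht.ne'
  have h := sum_pr_eq_mul p (fun ω (j : Fin n) => X j ω) (fun x => ∏ l, ψ l (x (e l)))
  simp only [funext_iff, hX] at h
  have hφ : ∀ x : Fin n → Fin t, ∏ l, ψ l (x (e l)) =
      ∏ j, ∏ l, if e l = j then ψ l (x j) else 1 := fun x => by
    rw [Finset.prod_comm]
    simp
  rw [← h]
  simp_rw [hφ]
  rw [← Finset.mul_sum, ← Fintype.prod_sum (fun j x => ∏ l, if e l = j then ψ l x else 1)]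
  have hc : (1 / (t : ℝ)) ^ n = ∏ _j : Fin n, 1 / (t : ℝ) := by simp
  have hr : ∏ l, (1 / (t : ℝ) * ∑ x, ψ l x) =
      ∏ j, ∏ l, if e l = j then 1 / (t : ℝ) * ∑ x, ψ l x else 1 := by
    rw [Finset.prod_comm]
    simp
  rw [hc, ← Finset.prod_mul_distrib, hr]
  refine Finset.prod_congr rfl fun j _ => ?_
  by_cases hj : ∃ l, e l = j
  · obtain ⟨l, rfl⟩ := hj
    simp [he.eq_iff]
  · have hj' : ∀ l, e l ≠ j := fun l hl => hj ⟨l, hl⟩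
    simp [hj', ht']

theorem pr_input_eq (hX : ∀ x : Fin n → Fin t,
      pr p (fun ω => ∀ j : Fin n, X j.1 ω = x j) = (1 / (t : ℝ)) ^ n) (ht : 0 < t)
    {a : ℕ} (ha : a < n) (x : Fin t) : pr p (fun ω => X a ω = x) = 1 / (t : ℝ) := by
  have h := sum_mul_prod_inputs hX ht (L := Unit) (e := fun _ => ⟨a, ha⟩)
    (fun _ _ _ => rfl) (fun _ y => if y = x then 1 else 0)
  simp only [univ_unique, prod_const, card_singleton, pow_one, mul_ite, mul_one, mul_zero,
    Finset.sum_ite_eq', Finset.mem_univ, if_true] at h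
  rw [← h]
  exact Finset.sum_congr rfl fun ω _ => by split_ifs <;> rfl

theorem Alg.posterior_pos (M : Alg Ω p (Fin t) n k X) (hp : IsPMF p) (ht : 0 < t)
    (hX : ∀ x : Fin n → Fin t,
      pr p (fun ω => ∀ j : Fin n, X j.1 ω = x j) = (1 / (t : ℝ)) ^ n)
    {a b : ℕ} (hab : a < b) (hb : b < n) (K : ℕ) {ω : Ω} (hω : 0 < p ω) :
    0 < M.posterior K a b ω := by
  obtain ⟨E, hE⟩ := M.exists_block_factor_lt hp ht hX hab hb K
  specialize hE (fun i => M.st i a ω) (fun i => M.st i b ω)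
  have h1 : 0 < pr p (fun ω' => ((∀ r < K, M.st r a ω' = M.st r a ω) ∧
      ∀ r < K, M.st r b ω' = M.st r b ω) ∧ X a ω' = X a ω) :=
    pr_pos hp hω ⟨⟨fun _ _ => rfl, fun _ _ => rfl⟩, rfl⟩
  have h2 : 0 < pr p (fun ω' => (∀ r < K, M.st r a ω' = M.st r a ω) ∧
      ∀ r < K, M.st r b ω' = M.st r b ω) :=
    pr_pos hp hω ⟨fun _ _ => rfl, fun _ _ => rfl⟩
  rw [Alg.posterior, ← pr_and_div_pr_eq_of_factor hE _ h1]
  exact div_pos h1 h2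

theorem Alg.posterior_zero (M : Alg Ω p (Fin t) n k X) (hp : IsPMF p) (ht : 0 < t)
    (hX : ∀ x : Fin n → Fin t,
      pr p (fun ω => ∀ j : Fin n, X j.1 ω = x j) = (1 / (t : ℝ)) ^ n)
    {a b : ℕ} (hab : a < b) (hb : b < n) {ω : Ω} (hω : 0 < p ω) :
    M.posterior 0 a b ω = 1 / (t : ℝ) := by
  obtain ⟨E, hE⟩ := M.exists_block_factor_lt hp ht hX hab hb 0
  specialize hE (fun i => M.st i a ω) (fun i => M.st i b ω)
  have h1 : 0 < pr p (fun ω' => ((∀ r < 0, M.st r a ω' = M.st r a ω) ∧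
      ∀ r < 0, M.st r b ω' = M.st r b ω) ∧ X a ω' = X a ω) :=
    pr_pos hp hω ⟨⟨fun _ _ => rfl, fun _ _ => rfl⟩, rfl⟩
  rw [Alg.posterior, ← pr_and_div_pr_eq_of_factor hE _ h1]
  have h2 := pr_input_eq hX ht (hab.trans hb) (X a ω)
  rw [pr_true hp (E := fun ω' => (∀ r < 0, M.st r a ω' = M.st r a ω) ∧
      ∀ r < 0, M.st r b ω' = M.st r b ω) fun ω' => by simp, div_one, ← h2]
  exact pr_congr fun ω' => by simp

/-- The information that the states at position `b` of the first `K` passes reveal about the input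
at position `a`. -/
theorem Alg.sum_condMI_eq (M : Alg Ω p (Fin t) n k X) (hp : IsPMF p) (ht : 0 < t)
    (hX : ∀ x : Fin n → Fin t,
      pr p (fun ω => ∀ j : Fin n, X j.1 ω = x j) = (1 / (t : ℝ)) ^ n)
    {a b : ℕ} (hab : a < b) (hb : b < n) (K : ℕ) :
    ∑ i ∈ Finset.range K, condMI p (M.st i b) (X a)
      (fun ω => ((fun r : Fin (i + 1) => M.st r.1 a ω), (fun r : Fin i => M.st r.1 b ω))) =
      ∑ ω, p ω * Real.logb 2 (t * M.posterior K a b ω) := by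
  have ht' : (t : ℝ) ≠ 0 := by exact_mod_cast ht.ne'
  simp_rw [M.condMI_eq_sum_posterior hp ht hX hab hb]
  rw [Finset.sum_comm]
  simp_rw [← Finset.mul_sum]
  refine sum_mul_congr hp fun ω hω => ?_
  rw [Finset.sum_range_sub (fun i => Real.logb 2 (M.posterior i a b ω)),
    M.posterior_zero hp ht hX hab hb hω,
    Real.logb_mul ht' (M.posterior_pos hp ht hX hab hb K hω).ne', one_div, Real.logb_inv]
  ring

/-- The likelihood ratio between the needle distribution with needle `α` and the uniform
distribution, at a coordinate with value `x`. -/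
def needleRatio (α x : Fin t) : ℝ :=
  1 / 2 + if x = α then (t : ℝ) / 2 else 0

theorem half_le_needleRatio (α x : Fin t) : 1 / 2 ≤ needleRatio α x := by
  unfold needleRatio
  split_ifs
  · have : (0 : ℝ) ≤ t := Nat.cast_nonneg t
    linarith
  · simp

theorem le_localNeedlePMF (ht : 0 < t) {q : ℕ} {P : ℕ → ℕ}
    (hP : ∀ a b, a < b → b ≤ q → P a < P b) (hPn : ∀ l ≤ q, P l < n) (x : Fin n → Fin t) :
    (1 / (t : ℝ)) ^ n * (1 / 2 * (1 / (t : ℝ) * ∑ α : Fin t,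
      ∏ l : Fin q, needleRatio α (x ⟨P l, hPn l l.2.le⟩))) ≤ localNeedlePMF t n (q + 1) P x := by
  have ht' : (0 : ℝ) < t := by exact_mod_cast ht
  simp only [localNeedlePMF]
  rw [Finset.mul_sum, Finset.mul_sum, Finset.mul_sum]
  refine Finset.sum_le_sum fun α _ => ?_
  let e : Fin (q + 1) → Fin n := fun l => ⟨P l, hPn l (Nat.lt_succ_iff.1 l.2)⟩
  have he : Function.Injective e := by
    intro a b hab
    have hab' : P a = P b := congrArg Fin.val hab
    rcases lt_trichotomy a b with h | h | h
    · have := hP a b h (Nat.lt_succ_iff.1 b.2)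
      omega
    · exact h
    · have := hP b a h (Nat.lt_succ_iff.1 a.2)
      omega
  have hmem : ∀ j : Fin n, (∃ l < q + 1, P l = j.1) ↔ j ∈ Finset.univ.image e := by
    intro j
    simp only [Finset.mem_image, Finset.mem_univ, true_and, e, Fin.ext_iff]
    exact ⟨fun ⟨l, hl, h⟩ => ⟨⟨l, hl⟩, h⟩, fun ⟨l, h⟩ => ⟨l, l.2, h⟩⟩
  have hprod : ∏ j : Fin n, (if ∃ l < q + 1, P l = j.1 then
        (if x j = α then 1 / 2 + 1 / (2 * (t : ℝ)) else 1 / (2 * (t : ℝ))) else 1 / (t : ℝ)) =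
      (1 / (t : ℝ)) ^ n * ∏ l : Fin (q + 1), needleRatio α (x (e l)) := by
    have h1 : ∀ j : Fin n, (if ∃ l < q + 1, P l = j.1 then
        (if x j = α then 1 / 2 + 1 / (2 * (t : ℝ)) else 1 / (2 * (t : ℝ))) else 1 / (t : ℝ)) =
        1 / (t : ℝ) * if j ∈ Finset.univ.image e then needleRatio α (x j) else 1 := by
      intro j
      simp only [hmem j, needleRatio]
      split_ifs <;> field_simp <;> ring
    simp_rw [h1]
    rw [Finset.prod_mul_distrib, Finset.prod_const, Finset.card_univ, Fintype.card_fin,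
      Finset.prod_ite_mem, Finset.univ_inter, Finset.prod_image fun a _ b _ h => he h]
  rw [hprod, Fin.prod_univ_castSucc]
  have hQ : 0 ≤ ∏ l : Fin q, needleRatio α (x (e l.castSucc)) :=
    Finset.prod_nonneg fun l _ => le_trans (by norm_num) (half_le_needleRatio α _)
  have hlast := mul_le_mul_of_nonneg_left (half_le_needleRatio α (x (e (Fin.last q)))) hQ
  have hc : 0 ≤ (1 / (t : ℝ)) ^ n * (1 / (t : ℝ)) := by positivity
  have := mul_le_mul_of_nonneg_left hlast hc
  refine le_trans (le_of_eq ?_) (this.trans (le_of_eq ?_))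
  · simp only [e, Fin.val_castSucc]
    ring
  · ring

/-- The probability that an output depending only on `F` takes the value `b`, given `F`. -/
def condOutput {S : Type} (p : Ω → ℝ) (Out : Ω → Bool) (F : Ω → S) (b : Bool) (s : S) : ℝ :=
  pr p (fun ω => Out ω = b ∧ F ω = s) / pr p (fun ω => F ω = s)

theorem pr_mono (hp : IsPMF p) {E E' : Ω → Prop} (h : ∀ ω, E ω → E' ω) : pr p E ≤ pr p E' := by
  refine Finset.sum_le_sum fun ω _ => ?_
  have := hp.nonneg ω
  split_ifs with h1 h2
  · exact le_rfl
  · exact absurd (h ω h1) h2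
  · exact this
  · exact le_rfl

theorem condOutput_nonneg {S : Type} (hp : IsPMF p) (Out : Ω → Bool) (F : Ω → S) (b : Bool)
    (s : S) : 0 ≤ condOutput p Out F b s :=
  div_nonneg (pr_nonneg hp _) (pr_nonneg hp _)

theorem condOutput_le_one {S : Type} (hp : IsPMF p) (Out : Ω → Bool) (F : Ω → S) (b : Bool)
    (s : S) : condOutput p Out F b s ≤ 1 :=
  div_le_one_of_le₀ (pr_mono hp fun _ h => h.2) (pr_nonneg hp _)

theorem condOutput_false {S : Type} (hp : IsPMF p) (Out : Ω → Bool) (F : Ω → S) {ω : Ω}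
    (hω : 0 < p ω) : condOutput p Out F false (F ω) = 1 - condOutput p Out F true (F ω) := by
  have h := sum_pr_and_eq p (fun ω' => F ω' = F ω) Out
  have hF : pr p (fun ω' => F ω' = F ω) ≠ 0 := (pr_pos hp hω (E := fun ω' => F ω' = F ω) rfl).ne'
  rw [Fintype.sum_bool] at h
  have hc : ∀ b, pr p (fun ω' => F ω' = F ω ∧ Out ω' = b) =
      pr p (fun ω' => Out ω' = b ∧ F ω' = F ω) := fun b => pr_congr fun _ => and_comm
  rw [hc, hc] at h
  simp only [condOutput]
  field_simp
  linarith

theorem pr_output_eq {S : Type} [Fintype S] (hp : IsPMF p) (Out : Ω → Bool) (F : Ω → S) (b : Bool)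
    (C : Ω → Prop)
    (hind : ∀ s, pr p (fun ω => Out ω = b ∧ C ω ∧ F ω = s) * pr p (fun ω => F ω = s) =
      pr p (fun ω => Out ω = b ∧ F ω = s) * pr p (fun ω => C ω ∧ F ω = s)) :
    pr p (fun ω => Out ω = b ∧ C ω) =
      ∑ ω, p ω * if C ω then condOutput p Out F b (F ω) else 0 := by
  have h1 : ∀ s, pr p (fun ω => (Out ω = b ∧ C ω) ∧ F ω = s) =
      pr p (fun ω => C ω ∧ F ω = s) * condOutput p Out F b s := by
    intro s
    have hle := pr_mono hp (E := fun ω => (Out ω = b ∧ C ω) ∧ F ω = s) (E' := fun ω => F ω = s)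
      fun _ h => h.2
    have hle' := pr_mono hp (E := fun ω => C ω ∧ F ω = s) (E' := fun ω => F ω = s)
      fun _ h => h.2
    rcases (pr_nonneg hp (fun ω => F ω = s)).eq_or_lt with h0 | h0
    · rw [← h0] at hle hle'
      rw [le_antisymm hle (pr_nonneg hp _), le_antisymm hle' (pr_nonneg hp _), zero_mul]
    · have := hind s
      simp only [condOutput, and_assoc]
      field_simp
      linarith
  rw [← sum_pr_and_eq p _ F]
  simp_rw [h1]
  simp only [pr, Finset.sum_mul, ite_mul, zero_mul]
  rw [Finset.sum_comm]
  refine Finset.sum_congr rfl fun ω _ => ?_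
  by_cases hC : C ω <;> simp [hC]

/-- Dropping the last position of the needle at most doubles the total error. -/
theorem sum_condOutput_le_two_mul_error (hp : IsPMF p) (ht : 0 < t)
    (hX : ∀ x : Fin n → Fin t,
      pr p (fun ω => ∀ j : Fin n, X j.1 ω = x j) = (1 / (t : ℝ)) ^ n)
    {q : ℕ} {P : ℕ → ℕ} (hP : ∀ a b, a < b → b ≤ q → P a < P b) (hPn : ∀ l ≤ q, P l < n)
    {S : Type} [Fintype S] (Out : Ω → Bool) (F : Ω → S)
    (hind : ∀ (b : Bool) (x : Fin n → Fin t) (s : S),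
      pr p (fun ω => Out ω = b ∧ (∀ j : Fin n, X j.1 ω = x j) ∧ F ω = s) *
          pr p (fun ω => F ω = s) =
        pr p (fun ω => Out ω = b ∧ F ω = s) *
          pr p (fun ω => (∀ j : Fin n, X j.1 ω = x j) ∧ F ω = s)) :
    ∑ ω, p ω * condOutput p Out F true (F ω) + 1 / (t : ℝ) * ∑ α : Fin t, ∑ ω, p ω *
      ((∏ l : Fin q, needleRatio α (X (P l) ω)) * (1 - condOutput p Out F true (F ω))) ≤
    2 * (pr p (fun ω => Out ω = true) + ∑ x : Fin n → Fin t, localNeedlePMF t n (q + 1) P x *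
      (pr p (fun ω => Out ω = false ∧ ∀ j : Fin n, X j.1 ω = x j) /
        pr p (fun ω => ∀ j : Fin n, X j.1 ω = x j))) := by
  have ht' : (0 : ℝ) < t := by exact_mod_cast ht
  have h0 : pr p (fun ω => Out ω = true) = ∑ ω, p ω * condOutput p Out F true (F ω) := by
    have h := pr_output_eq hp Out F true (fun _ => True) fun s => by simp
    simpa using h
  have h1 : 1 / 2 * (1 / (t : ℝ) * ∑ α : Fin t, ∑ ω, p ω *
      ((∏ l : Fin q, needleRatio α (X (P l) ω)) * (1 - condOutput p Out F true (F ω)))) ≤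
      ∑ x : Fin n → Fin t, localNeedlePMF t n (q + 1) P x *
      (pr p (fun ω => Out ω = false ∧ ∀ j : Fin n, X j.1 ω = x j) /
        pr p (fun ω => ∀ j : Fin n, X j.1 ω = x j)) := by
    have h2 : ∀ x : Fin n → Fin t,
        1 / 2 * (1 / (t : ℝ) * ∑ α : Fin t, ∏ l : Fin q,
          needleRatio α (x ⟨P l, hPn l l.2.le⟩)) *
            pr p (fun ω => Out ω = false ∧ ∀ j : Fin n, X j.1 ω = x j) ≤
        localNeedlePMF t n (q + 1) P x *
        (pr p (fun ω => Out ω = false ∧ ∀ j : Fin n, X j.1 ω = x j) /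
          pr p (fun ω => ∀ j : Fin n, X j.1 ω = x j)) := by
      intro x
      rw [hX, ← mul_div_assoc,
        le_div_iff₀ (by positivity), mul_right_comm]
      refine mul_le_mul_of_nonneg_right ?_ (pr_nonneg hp _)
      rw [mul_comm]
      exact le_localNeedlePMF ht hP hPn x
    refine le_trans (le_of_eq ?_) (Finset.sum_le_sum fun x _ => h2 x)
    have h3 : ∀ α : Fin t, ∑ ω, p ω * ((∏ l : Fin q, needleRatio α (X (P l) ω)) *
        (1 - condOutput p Out F true (F ω))) = ∑ ω, p ω *
        ((∏ l : Fin q, needleRatio α (X (P l) ω)) * condOutput p Out F false (F ω)) := fun α =>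
      sum_mul_congr hp fun ω hω => by rw [condOutput_false hp Out F hω]
    have h4 := fun x : Fin n → Fin t => pr_output_eq hp Out F false _ (hind false x)
    simp_rw [h3, h4]
    rw [Finset.sum_comm, Finset.mul_sum, Finset.mul_sum]
    simp_rw [Finset.mul_sum (s := (Finset.univ : Finset Ω))]
    rw [Finset.sum_comm]
    refine Finset.sum_congr rfl fun ω _ => ?_
    rw [Finset.sum_eq_single fun j : Fin n => X j ω]
    · simp only [implies_true, if_true]
      rw [← Finset.mul_sum]
      simp_rw [← Finset.sum_mul]
      ring
    · intro x _ hx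
      rw [if_neg fun h => hx (funext fun j => (h j).symm)]
      simp
    · simp
  have h2 : 0 ≤ pr p (fun ω => Out ω = true) := pr_nonneg hp _
  linarith

theorem Alg.information_ge_of_error_le (M : Alg Ω p (Fin t) n k X) (hp : IsPMF p) (ht : 0 < t)
    (hX : ∀ x : Fin n → Fin t,
      pr p (fun ω => ∀ j : Fin n, X j.1 ω = x j) = (1 / (t : ℝ)) ^ n)
    {q : ℕ} {P : ℕ → ℕ} (hP : ∀ a b, a < b → b ≤ q → P a < P b) (hPn : ∀ l ≤ q, P l < n)
    (K : ℕ) {o : M.S → ℝ} (h0 : ∀ s, 0 ≤ o s) (h1 : ∀ s, o s ≤ 1)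
    (herr : ∑ ω, p ω * o (M.st K (P 0) ω) + 1 / (t : ℝ) * ∑ α : Fin t, ∑ ω, p ω *
      ((∏ l : Fin q, needleRatio α (X (P l) ω)) * (1 - o (M.st K (P 0) ω))) ≤ 1 / 5) :
    3 / 10 ≤ ∑ l : Fin q, ∑ ω, p ω *
      Real.log (t * M.posterior K (P l) (P (l + 1)) ω) := by
  obtain ⟨E, hE⟩ := M.exists_transcript_factor hp ht hX hP (hPn q le_rfl) K
  let ext : (Fin K → Fin (q + 1) → M.S) × M.S → ℕ → ℕ → M.S := fun η i l =>
    if h : i < K ∧ l < q + 1 then η.1 ⟨i, h.1⟩ ⟨l, h.2⟩ else η.2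
  let y : Ω → (Fin K → Fin (q + 1) → M.S) × M.S := fun ω =>
    (fun i l => M.st i (P l) ω, M.st K (P 0) ω)
  let g : Fin q → (Fin K → Fin (q + 1) → M.S) × M.S → Fin t → ℝ := fun l η =>
    M.blockWeight K (P l) (P (l + 1) - P l) (fun i => ext η i l) (fun i => ext η i (l + 1))
  have hinj : Function.Injective fun l : Fin q => (⟨P l, hPn l l.2.le⟩ : Fin n) := by
    intro a b hab
    have hab' : P a = P b := congrArg Fin.val hab
    rcases lt_trichotomy a b with h | h | h
    · have := hP a b h b.2.le
      omega
    · exact h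
    · have := hP b a h a.2.le
      omega
  have hext : ∀ η i (hi : i < K) l (hl : l < q + 1), ext η i l = η.1 ⟨i, hi⟩ ⟨l, hl⟩ :=
    fun η i hi l hl => by simp only [ext, hi, hl, and_self, dite_true]
  have hfac : ∀ η (x : Fin q → Fin t), pr p (fun ω => y ω = η ∧ ∀ l : Fin q, X (P l) ω = x l) =
      E (ext η) * ∏ l, g l η (x l) := by
    intro η x
    have h := hE (ext η) fun l => if h : l < q then x ⟨l, h⟩ else ⟨0, ht⟩
    rw [Finset.prod_range] at h
    simp only [Fin.is_lt, dite_true, Fin.eta] at h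
    rw [← h]
    refine pr_congr fun ω => and_congr ?_ ?_
    · simp only [y, Prod.ext_iff, funext_iff, Fin.forall_iff]
      refine and_congr ?_ ?_
      · refine forall₂_congr fun i hi => ?_
        refine ⟨fun h l hl => ?_, fun h l hl => ?_⟩
        · rw [h l (Nat.lt_succ_iff.2 hl)]
          rw [hext η i hi l (Nat.lt_succ_iff.2 hl)]
        · rw [h l (Nat.lt_succ_iff.1 hl)]
          rw [hext η i hi l hl]
      · simp [ext]
    · rw [Fin.forall_iff]
      exact forall₂_congr fun l hl => by rw [dif_pos hl]
  have hy : ∀ ω, ∀ i < K, ∀ l < q + 1, ext (y ω) i l = M.st i (P l) ω := fun ω i hi l hl =>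
    hext (y ω) i hi l hl
  have h := information_ge_of_distinguishing (y := y) (Z := fun l : Fin q => X (P l))
    (E := fun η => E (ext η)) (g := g) (o := fun η => o η.2) ht hp
    (fun l η x => M.blockWeight_nonneg hp _ _ _ _ _ x) hfac
    (fun ψ => sum_mul_prod_inputs hX ht hinj ψ) (fun η => h0 _) (fun η => h1 _) herr
  refine h.trans (le_of_eq (Finset.sum_congr rfl fun l _ => Finset.sum_congr rfl fun ω _ => ?_))
  have hg : ∀ x, g l (y ω) x = M.blockWeight K (P l) (P (l + 1) - P l)
      (fun i => M.st i (P l) ω) (fun i => M.st i (P (l + 1)) ω) x := fun x =>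
    M.blockWeight_congr K _ _ (fun i hi => hy ω i hi l (by omega))
      (fun i hi => hy ω i hi (l + 1) (by omega)) x
  simp only [hg, Alg.posterior, mul_div_assoc]

theorem Alg.passEnd_eq_st (M : Alg Ω p (Fin t) n k X) {K : ℕ}
    (hconst : ∀ j ≤ n, ∀ ω, M.st K j ω = M.passEnd K ω) {j : ℕ} (hj : j ≤ n) :
    M.passEnd (K + 1) = M.st K j := by
  funext ω
  rw [hconst j hj, ← hconst n le_rfl]
  rfl

end Streaming

/-- Lemma `lem:sup`: there is an absolute constant `c > 0` such that
the following holds.  Let `S = {p_1 < … < p_m} ⊆ [n]` with `m ≤ t/100` (here `P l` is the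
0-indexed position `p_{l+1} - 1`), with the convention that for `j = m` the state
`M_{(i, p_{m+1}-1)}` denotes `M_{(i+1, p_1-1)}` (the sum wraps to the next pass).  Let
`M` be a `k`-pass streaming algorithm on streams in `[t]^n` whose memory does not change
during its `k`-th pass, with an output bit that is a (possibly randomized) function of
the final memory state.  If `Pr[out = 1 | D0] + Pr[out = 0 | D^S] ≤ 0.1`, then
`Σ_{i=1}^{k-1} Σ_{j=1}^{m} Σ_{ℓ=1}^{j}
   I(M_{(i,p_{j+1}-1)}; X_{p_ℓ} | M_{(≤i,p_ℓ-1)}, M_{(≤i-1,p_{j+1}-1)}) ≥ c`,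
where `X ∼ D0`. -/
theorem local_needle_information_lower_bound :
    ∃ c : ℝ, 0 < c ∧
      ∀ (t n m : ℕ) (P : ℕ → ℕ), 1 ≤ m → 100 * m ≤ t →
        (∀ a b : ℕ, a < b → b < m → P a < P b) →
        (∀ l < m, P l < n) →
        ∀ (k : ℕ), 1 ≤ k →
        ∀ (Ω : Type) [Fintype Ω], ∀ (p : Ω → ℝ) (X : ℕ → Ω → Fin t)
          (M : Alg Ω p (Fin t) n k X) (Out : Ω → Bool),
          IsPMF p →
          -- the input is distributed according to `D0` (i.i.d. uniform on `[t]`):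
          (∀ x : Fin n → Fin t,
            pr p (fun ω => ∀ j : Fin n, X j.1 ω = x j) = (1 / (t : ℝ)) ^ n) →
          -- the memory does not change during the `k`-th pass:
          (∀ j ≤ n, ∀ ω, M.st (k - 1) j ω = M.passEnd (k - 1) ω) →
          -- `Out` is conditionally independent of the input given the final state:
          (∀ (b : Bool) (x : Fin n → Fin t) (m' : M.S),
            pr p (fun ω => Out ω = b ∧ (∀ j : Fin n, X j.1 ω = x j) ∧
                  M.passEnd k ω = m') *
                pr p (fun ω => M.passEnd k ω = m')
              = pr p (fun ω => Out ω = b ∧ M.passEnd k ω = m') *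
                pr p (fun ω => (∀ j : Fin n, X j.1 ω = x j) ∧ M.passEnd k ω = m')) →
          -- the total error for distinguishing `D0` from `D^S` is at most `0.1`:
          pr p (fun ω => Out ω = true)
              + (∑ x : Fin n → Fin t, localNeedlePMF t n m P x *
                  (pr p (fun ω => Out ω = false ∧ ∀ j : Fin n, X j.1 ω = x j) /
                    pr p (fun ω => ∀ j : Fin n, X j.1 ω = x j)))
            ≤ 0.1 →
          c ≤ ∑ i ∈ Finset.range (k - 1), ∑ j ∈ Finset.range m, ∑ l ∈ Finset.range (j + 1),
              condMI p
                (if j + 1 < m then M.st i (P (j + 1)) else M.st (i + 1) (P 0))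
                (X (P l))
                (fun ω => ((fun r : Fin (i + 1) => M.st r.1 (P l) ω),
                  (if j + 1 < m then (fun r : Fin i => M.st r.1 (P (j + 1)) ω)
                   else (fun r : Fin i => M.st (r.1 + 1) (P 0) ω)))) := by
  refine ⟨3 / 10, by norm_num, ?_⟩
  intro t n m P hm hmt hP hPn k hk Ω _ p X M Out hp hX hconst hind herr
  obtain ⟨q, rfl⟩ := Nat.exists_eq_add_of_le' hm
  obtain ⟨K, rfl⟩ := Nat.exists_eq_add_of_le' hk
  simp only [Nat.add_sub_cancel] at hconst ⊢
  have ht : 0 < t := by omega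
  have hP' : ∀ a b, a < b → b ≤ q → P a < P b := fun a b hab hb => hP a b hab (by omega)
  have hPn' : ∀ l ≤ q, P l < n := fun l hl => hPn l (by omega)
  have hend := M.passEnd_eq_st hconst (hPn' 0 (Nat.zero_le q)).le
  rw [hend] at hind
  have herr' := (sum_condOutput_le_two_mul_error hp ht hX hP' hPn' Out _ hind).trans
    ((mul_le_mul_of_nonneg_left herr zero_le_two).trans (by norm_num : _ ≤ (1 : ℝ) / 5))
  have hinfo := M.information_ge_of_error_le hp ht hX hP' hPn' K
    (condOutput_nonneg hp Out _ true) (condOutput_le_one hp Out _ true) herr'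
  have hlog : Real.log 2 ≤ 1 := by linarith [Real.log_two_lt_d9]
  have hlog0 : 0 < Real.log 2 := Real.log_pos (by norm_num)
  have hdiag : ∑ l : Fin q, ∑ ω, p ω * Real.log (t * M.posterior K (P l) (P (l + 1)) ω) =
      Real.log 2 * ∑ i ∈ Finset.range K, ∑ l ∈ Finset.range q,
        condMI p (M.st i (P (l + 1))) (X (P l))
          (fun ω => ((fun r : Fin (i + 1) => M.st r.1 (P l) ω),
            (fun r : Fin i => M.st r.1 (P (l + 1)) ω))) := by
    rw [Finset.sum_comm (s := Finset.range K), Finset.sum_range, Finset.mul_sum]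
    refine Finset.sum_congr rfl fun l _ => ?_
    rw [M.sum_condMI_eq hp ht hX (hP' l (l + 1) (by omega) (by omega)) (hPn' (l + 1) (by omega)),
      Finset.mul_sum]
    refine Finset.sum_congr rfl fun ω _ => ?_
    rw [Real.logb]
    field_simp
  rw [hdiag] at hinfo
  have hnonneg : 0 ≤ ∑ i ∈ Finset.range K, ∑ l ∈ Finset.range q,
      condMI p (M.st i (P (l + 1))) (X (P l))
        (fun ω => ((fun r : Fin (i + 1) => M.st r.1 (P l) ω),
          (fun r : Fin i => M.st r.1 (P (l + 1)) ω))) :=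
    Finset.sum_nonneg fun i _ => Finset.sum_nonneg fun l _ => condMI_nonneg hp _ _ _
  refine (hinfo.trans (mul_le_of_le_one_left hnonneg hlog)).trans
    (Finset.sum_le_sum fun i _ => ?_)
  rw [Finset.sum_range_succ]
  refine le_add_of_le_of_nonneg (Finset.sum_le_sum fun j hj => ?_)
    (Finset.sum_nonneg fun l _ => condMI_nonneg hp _ _ _)
  have hj' : j + 1 < q + 1 := by simpa using hj
  rw [Finset.sum_range_succ]
  refine le_add_of_nonneg_of_le (Finset.sum_nonneg fun l _ => condMI_nonneg hp _ _ _) ?_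
  simp only [if_pos hj', le_refl]

end MultiPassIC
end
end

section
/- For all n ≥ 4 and all real γ, B with γ > 4/√n and B > γ·√n, there exists a one-pass streaming algorithm Apr on input streams a ∈ {-1,0,1}^n (with per-step private randomness, memory states Apr_0, Apr_1, …, Apr_n taking values in a finite set, and a real-valued output that is a deterministic function of Apr_n) such that: (i) for every fixed input a ∈ {-1,0,1}^n, with probability at least 1 - 1/n³ over the private randomness, |output − Σ_{j=1}^n a_j| ≤ (γ/2)·√n, and consequently for every distribution D on {-1,0,1}^n, E[(output − Σ_{j=1}^n a_j)²] ≤ γ²·n; and (ii) for every distribution D on {-1,0,1}^n with E_{a∼D}[Σ_{j=1}^n 1_{a_j ≠ 0}] ≤ B, for all j ∈ {0,1,…,n}, H(Apr_j) ≤ 40 + 6·log₂ log₂ n + 2·log₂(B/(γ·√n)). -/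
open scoped Classical
open Finset

noncomputable section

namespace ApproxSum

/-- Probability of an event under a probability mass function `p` on a finite sample space. -/
def pr {Ω : Type} [Fintype Ω] (p : Ω → ℝ) (E : Ω → Prop) : ℝ :=
  ∑ ω, if E ω then p ω else 0

/-- `p` is a probability mass function on the finite type `Ω`. -/
structure IsPMF {Ω : Type} [Fintype Ω] (p : Ω → ℝ) : Prop where
  nonneg : ∀ ω, 0 ≤ p ω
  sum_one : ∑ ω, p ω = 1

/-- Shannon entropy (base 2) of the random variable `A` under `p`. -/
def H {Ω : Type} [Fintype Ω] {α : Type} [Fintype α] (p : Ω → ℝ) (A : Ω → α) : ℝ :=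
  -∑ a, pr p (fun ω => A ω = a) * Real.logb 2 (pr p (fun ω => A ω = a))

/-- A one-pass streaming algorithm on (deterministic) integer input streams, with
internal randomness on the finite sample space `Ω` with pmf `p`: `S` is the finite set of
memory states, `Rv` the value space of the per-step private randomness, `s0` the
(deterministic) starting state `Apr_0`, `R j` the private randomness used at step `j`
(0-indexed), `f j` the corresponding transition function, and `out` the real-valued
output, a deterministic function of the final memory state.  The field `indep` states
that the per-step random seeds are mutually independent. -/
structure OnePass (Ω : Type) [Fintype Ω] (p : Ω → ℝ) (n : ℕ) where
  S : Type
  fintS : Fintype S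
  Rv : Type
  fintR : Fintype Rv
  s0 : S
  R : ℕ → Ω → Rv
  f : ℕ → ℤ → S → Rv → S
  out : S → ℝ
  indep : ∀ r : ℕ → Rv,
    pr p (fun ω => ∀ j < n, R j ω = r j)
      = ∏ j ∈ Finset.range n, pr p (fun ω => R j ω = r j)

attribute [instance] OnePass.fintS OnePass.fintR

variable {Ω : Type} [Fintype Ω] {p : Ω → ℝ} {n : ℕ}

/-- `A.run x j` is the memory state `Apr_j` after reading the first `j` elements of the
input stream `x`. -/
def OnePass.run (A : OnePass Ω p n) (x : ℕ → ℤ) : ℕ → Ω → A.S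
  | 0 => fun _ => A.s0
  | j + 1 => fun ω =>
      if j < n then A.f j (x j) (A.run x j ω) (A.R j ω) else A.run x j ω

/-- Encoding of a `{-1,0,1}`-valued input of length `n` (given as a tuple in `(Fin 3)^n`,
where `0 ↦ -1`, `1 ↦ 0`, `2 ↦ 1`) as an integer stream. -/
def ext3 (n : ℕ) (x : Fin n → Fin 3) : ℕ → ℤ :=
  fun j => if h : j < n then ((x ⟨j, h⟩ : ℕ) : ℤ) - 1 else 0

/-- The trajectory of a process driven by the coordinates of `ω`. -/
def traj {R X : Type} {n : ℕ} (F : ℕ → X → R → X) (z₀ : X) : ℕ → (Fin n → R) → X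
  | 0, _ => z₀
  | j + 1, ω => if h : j < n then F j (traj F z₀ j ω) (ω ⟨j, h⟩) else traj F z₀ j ω

theorem traj_update {R X : Type} {n : ℕ} (F : ℕ → X → R → X) (z₀ : X) (i : Fin n)
    (ω : Fin n → R) (r : R) :
    ∀ j ≤ i.1, traj F z₀ j (Function.update ω i r) = traj F z₀ j ω := by
  intro j
  induction j with
  | zero => intro _; rfl
  | succ j ih =>
    intro hj
    have hne : ∀ h : j < n, (⟨j, h⟩ : Fin n) ≠ i := by
      intro h he
      have := congrArg Fin.val he
      simp at this
      omega
    simp only [traj, ih (by omega)]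
    split_ifs with h
    · rw [Function.update_of_ne (hne h)]
    · rfl

/-- Resampling one coordinate of a uniformly distributed tuple preserves its distribution. -/
theorem sum_update {R : Type} [Fintype R] {n : ℕ} (i : Fin n) (f : (Fin n → R) → ℝ) :
    ∑ ω : Fin n → R, ∑ r, f (Function.update ω i r) = Fintype.card R * ∑ ω, f ω := by
  have hinv : Function.Involutive
      (fun q : (Fin n → R) × R => (Function.update q.1 i q.2, q.1 i)) := by
    rintro ⟨ω, r⟩
    simp
  have h := Equiv.sum_comp hinv.toPerm (fun q : (Fin n → R) × R => f q.1)
  rw [Fintype.sum_prod_type, Fintype.sum_prod_type] at h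
  simp only [Function.Involutive.coe_toPerm, Finset.sum_const, Finset.card_univ,
    nsmul_eq_mul] at h
  rw [h, Finset.mul_sum]

/-- A potential that does not increase on average under each step of the process does not
increase on average along the trajectory. -/
theorem sum_traj_le {R X : Type} [Fintype R] [Nonempty R] {n : ℕ} (F : ℕ → X → R → X) (z₀ : X)
    (h : ℕ → X → ℝ) (hF : ∀ j < n, ∀ z, ∑ r, h (j + 1) (F j z r) ≤ Fintype.card R * h j z) :
    ∀ j ≤ n, ∑ ω : Fin n → R, h j (traj F z₀ j ω) ≤ Fintype.card (Fin n → R) * h 0 z₀ := by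
  intro j
  induction j with
  | zero => intro _; simp [traj]
  | succ j ih =>
    intro hj
    refine le_trans ?_ (ih (by omega))
    have hc : (0 : ℝ) < Fintype.card R := by exact_mod_cast Fintype.card_pos
    refine le_of_mul_le_mul_left ?_ hc
    rw [← sum_update ⟨j, hj⟩, Finset.mul_sum]
    refine Finset.sum_le_sum fun ω _ => ?_
    refine le_trans (le_of_eq ?_) (hF j hj _)
    refine Finset.sum_congr rfl fun r _ => ?_
    have hj' : j < n := hj
    simp only [traj, hj', dif_pos, Function.update_self]
    rw [traj_update F z₀ ⟨j, hj⟩ ω r j le_rfl]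

/-- The uniform probability mass function. -/
def unif (Ω : Type) [Fintype Ω] : Ω → ℝ := fun _ => (Fintype.card Ω : ℝ)⁻¹

theorem isPMF_unif (Ω : Type) [Fintype Ω] [Nonempty Ω] : IsPMF (unif Ω) where
  nonneg _ := by unfold unif; positivity
  sum_one := by simp [unif]

/-- Extension of a tuple of seeds to all natural-number indices. -/
def seed {R : Type} [Inhabited R] {n : ℕ} (j : ℕ) (ω : Fin n → R) : R :=
  if h : j < n then ω ⟨j, h⟩ else default

theorem pr_seed_eq {R : Type} [Fintype R] [Inhabited R] {n j : ℕ} (hj : j < n) (r : R) :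
    pr (unif (Fin n → R)) (fun ω => seed j ω = r) = (Fintype.card R : ℝ)⁻¹ := by
  have h := sum_update (⟨j, hj⟩ : Fin n)
    (fun ω => if ω ⟨j, hj⟩ = r then unif (Fin n → R) ω else 0)
  simp only [Function.update_self, unif, Finset.sum_ite_eq', Finset.mem_univ, if_true,
    Finset.sum_const, Finset.card_univ, nsmul_eq_mul] at h
  rw [mul_inv_cancel₀ (by exact_mod_cast Fintype.card_ne_zero)] at h
  simp only [pr, seed, hj, dif_pos, unif]
  exact eq_inv_of_mul_eq_one_right h.symm

theorem seed_indep {R : Type} [Fintype R] [Inhabited R] {n : ℕ} (r : ℕ → R) :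
    pr (unif (Fin n → R)) (fun ω => ∀ j < n, seed j ω = r j)
      = ∏ j ∈ Finset.range n, pr (unif (Fin n → R)) (fun ω => seed j ω = r j) := by
  rw [Finset.prod_congr rfl fun j hj => pr_seed_eq (Finset.mem_range.1 hj) (r j)]
  have h : ∀ ω : Fin n → R, (∀ j < n, seed j ω = r j) ↔ ω = fun i => r i.1 := by
    intro ω
    constructor
    · intro h
      funext i
      have := h i.1 i.2
      simpa [seed] using this
    · rintro rfl j hj
      simp [seed, hj]
  simp [pr, h, unif]

/-- Gibbs' inequality: entropy is at most the expected length of any code whose lengths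
satisfy Kraft's inequality. -/
theorem H_le_of_kraft {Ω α : Type} [Fintype Ω] [Fintype α] {p : Ω → ℝ} (hp : IsPMF p)
    (A : Ω → α) (q : α → ℝ) (hq : ∀ a, 0 < q a) (hq1 : ∑ a, q a ≤ 1) :
    H p A ≤ ∑ ω, p ω * -Real.logb 2 (q (A ω)) := by
  set P : α → ℝ := fun a => pr p (fun ω => A ω = a) with hP
  have hP0 : ∀ a, 0 ≤ P a := fun a => Finset.sum_nonneg fun ω _ => by
    split_ifs
    · exact hp.nonneg ω
    · exact le_rfl
  have hfib : ∀ g : α → ℝ, ∑ ω, p ω * g (A ω) = ∑ a, P a * g a := by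
    intro g
    simp only [hP, pr, Finset.sum_mul]
    rw [Finset.sum_comm]
    refine Finset.sum_congr rfl fun ω _ => ?_
    simp [ite_mul]
  have hP1 : ∑ a, P a = 1 := by
    have := hfib fun _ => 1
    simpa [hp.sum_one] using this.symm
  rw [hfib fun a => -Real.logb 2 (q a)]
  have key : ∀ a, P a * Real.log (q a) - P a * Real.log (P a) ≤ q a - P a := by
    intro a
    rcases (hP0 a).eq_or_lt with h | h
    · rw [← h]; simpa using (hq a).le
    · have := Real.log_le_sub_one_of_pos (div_pos (hq a) h)
      rw [Real.log_div (hq a).ne' h.ne'] at this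
      have := mul_le_mul_of_nonneg_left this h.le
      rw [mul_sub, mul_sub, mul_div_cancel₀ _ h.ne', mul_one] at this
      exact this
  have hs := Finset.sum_le_sum fun a (_ : a ∈ Finset.univ) => key a
  rw [Finset.sum_sub_distrib, Finset.sum_sub_distrib, hP1] at hs
  have h2 : 0 < Real.log 2 := Real.log_pos one_lt_two
  have e1 : ∑ a, P a * -Real.logb 2 (q a) = -(∑ a, P a * Real.log (q a)) / Real.log 2 := by
    rw [← Finset.sum_neg_distrib, Finset.sum_div]
    refine Finset.sum_congr rfl fun a _ => ?_
    rw [Real.logb]; ring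
  have e2 : H p A = -(∑ a, P a * Real.log (P a)) / Real.log 2 := by
    rw [H, ← Finset.sum_neg_distrib, ← Finset.sum_neg_distrib, Finset.sum_div]
    refine Finset.sum_congr rfl fun a _ => ?_
    simp only [Real.logb, hP]; ring
  rw [e1, e2]
  exact div_le_div_of_nonneg_right (by linarith) h2.le

/-- The exponent of the counting unit `2 ^ (τ - b - k)` used at level `k`. -/
def unitExp (τ b k : ℕ) : ℕ := τ - b - k

/-- The integer represented by a memory state `(level, count)`. -/
def value (τ b : ℕ) (z : ℕ × ℤ) : ℤ := z.2 * 2 ^ unitExp τ b z.1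

/-- A pair of independent seeds: the first decides sampling, the second level increments. -/
abbrev Seed (Q : ℕ) : Type := Fin (2 ^ Q) × Fin (2 ^ Q)

instance (Q : ℕ) : Inhabited (Seed Q) := ⟨(⟨0, by positivity⟩, ⟨0, by positivity⟩)⟩

/-- The count after possibly sampling the nonzero input `a`. -/
def sampled (K τ b : ℕ) (a : ℤ) (z : ℕ × ℤ) (r : Fin (2 ^ (τ + K))) : ℤ :=
  if r.1 < 2 ^ (τ + K - unitExp τ b z.1) then z.2 + a else z.2

/-- One step of the counter: a nonzero input is sampled with probability inverse to the current
unit, and the level `k` is incremented with probability `2 ^ (-τ - k)`, or when the count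
overflows. -/
def step (K τ b : ℕ) (a : ℤ) (z : ℕ × ℤ) (r : Seed (τ + K)) : ℕ × ℤ :=
  if a = 0 then z
  else if (z.1 < K ∧ r.2.1 < 2 ^ (K - z.1)) ∨ 4 ^ z.1 * 2 ^ (b + 1) < |sampled K τ b a z r.1| then
    (z.1 + 1, sampled K τ b a z r.1 * 2 ^ (unitExp τ b z.1 - unitExp τ b (z.1 + 1)))
  else (z.1, sampled K τ b a z r.1)

theorem value_step {K τ b : ℕ} {a : ℤ} (ha : a ≠ 0) (z : ℕ × ℤ) (r : Seed (τ + K)) :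
    value τ b (step K τ b a z r) = value τ b z +
      if r.1.1 < 2 ^ (τ + K - unitExp τ b z.1) then a * 2 ^ unitExp τ b z.1 else 0 := by
  have hs : sampled K τ b a z r.1 * 2 ^ unitExp τ b z.1 = value τ b z +
      if r.1.1 < 2 ^ (τ + K - unitExp τ b z.1) then a * 2 ^ unitExp τ b z.1 else 0 := by
    unfold sampled value
    split_ifs <;> ring
  rw [← hs, step, if_neg ha]
  split_ifs
  · have : unitExp τ b z.1 - unitExp τ b (z.1 + 1) + unitExp τ b (z.1 + 1) = unitExp τ b z.1 := by
      unfold unitExp; omega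
    simp only [value, mul_assoc, ← pow_add, this]
  · rfl

theorem sum_bernoulli {Q e : ℕ} (he : e ≤ Q) (A B : ℝ) :
    ∑ r : Fin (2 ^ Q), (if r.1 < 2 ^ (Q - e) then A else B)
      = 2 ^ Q * ((2 ^ e)⁻¹ * A + (1 - (2 ^ e)⁻¹) * B) := by
  have h1 : (2 : ℝ) ^ Q * (2 ^ e)⁻¹ = 2 ^ (Q - e) := by
    rw [pow_sub₀ _ two_ne_zero he]
  have h2 : ∀ N c : ℕ, c ≤ N → ∑ r ∈ Finset.range N, (if r < c then A else B)
      = c * A + ((N : ℝ) - c) * B := by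
    intro N c hc
    obtain ⟨d, rfl⟩ := Nat.exists_eq_add_of_le hc
    rw [Finset.sum_range_add, Finset.sum_congr rfl fun r hr => if_pos (Finset.mem_range.1 hr),
      Finset.sum_congr (s₂ := Finset.range d) rfl fun r _ => if_neg (by omega)]
    simp
  rw [Fin.sum_univ_eq_sum_range (fun r => if r < 2 ^ (Q - e) then A else B),
    h2 _ _ (Nat.pow_le_pow_right two_pos (Nat.sub_le _ _))]
  push_cast
  rw [← h1]
  ring

/-- The exponential moment of a centered sampling error. -/
theorem exp_moment_le {u y : ℝ} (hu : 1 ≤ u) (hy : u = 1 ∨ |y| * u ≤ 1) :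
    u⁻¹ * Real.exp (y * (u - 1)) + (1 - u⁻¹) * Real.exp (-y) ≤ 1 + y ^ 2 * (u - 1) := by
  rcases hy with rfl | hy
  · simp
  have hu0 : 0 < u := by linarith
  have hy0 := abs_nonneg y
  have key : ∀ t : ℝ, |t| ≤ 1 → Real.exp t ≤ 1 + t + t ^ 2 := by
    intro t ht
    have := (abs_le.1 (Real.abs_exp_sub_one_sub_id_le ht)).2
    linarith
  have h1 := key (y * (u - 1)) (by
    rw [abs_mul, abs_of_nonneg (by linarith : 0 ≤ u - 1)]
    nlinarith)
  have h2 := key (-y) (by rw [abs_neg]; nlinarith)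
  have hui : 0 ≤ 1 - u⁻¹ := by
    have := inv_le_one_of_one_le₀ hu
    linarith
  calc _ ≤ u⁻¹ * (1 + y * (u - 1) + (y * (u - 1)) ^ 2) + (1 - u⁻¹) * (1 + -y + (-y) ^ 2) := by
        gcongr
    _ = 1 + y ^ 2 * (u - 1) := by field_simp; ring

theorem card_seed (Q : ℕ) : (Fintype.card (Seed Q) : ℝ) = 2 ^ Q * 2 ^ Q := by
  simp [Seed]

theorem two_pow_unitExp_of_pos {τ b k : ℕ} (h : unitExp τ b k ≠ 0) :
    (2 : ℝ) ^ unitExp τ b k * 2 ^ b * 2 ^ k = 2 ^ τ := by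
  rw [← pow_add, ← pow_add]
  congr 1
  unfold unitExp at *
  omega

theorem sum_exp_step_le {K τ b : ℕ} (hK : τ ≤ K) {l : ℝ} (hl : 2 * (l * 2 ^ τ) ^ 2 ≤ 2 ^ b)
    {a : ℤ} (ha : a = -1 ∨ a = 0 ∨ a = 1) (σ : ℝ) (z : ℕ × ℤ) :
    ∑ r, Real.exp (l * (value τ b (step K τ b a z r) - (σ + a))) / 2 ^ (step K τ b a z r).1
      ≤ Fintype.card (Seed (τ + K)) * (Real.exp (l * (value τ b z - σ)) / 2 ^ z.1) := by
  by_cases ha0 : a = 0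
  · subst ha0
    simp [step]
  have ha2 : (a : ℝ) ^ 2 = 1 := by
    rcases ha with h | h | h
    · simp [h]
    · exact absurd h ha0
    · simp [h]
  have habs : |(a : ℝ)| = 1 := by
    rw [← Real.sqrt_sq_eq_abs, ha2, Real.sqrt_one]
  set e := unitExp τ b z.1 with he
  set k := z.1 with hk
  set c := Real.exp (l * (value τ b z - σ)) / 2 ^ k with hc
  have hc0 : 0 ≤ c := by positivity
  set A : Fin (2 ^ (τ + K)) → ℝ := fun r => if r.1 < 2 ^ (τ + K - e) then
    Real.exp (l * a * (2 ^ e - 1)) else Real.exp (-(l * a)) with hA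
  set J : Fin (2 ^ (τ + K)) → ℝ := fun r =>
    if k < K ∧ r.1 < 2 ^ (K - k) then 1 / 2 else 1 with hJ
  have hpt : ∀ r : Seed (τ + K),
      Real.exp (l * (value τ b (step K τ b a z r) - (σ + a))) / 2 ^ (step K τ b a z r).1
        ≤ c * (A r.1 * J r.2) := by
    intro r
    have h1 : Real.exp (l * (value τ b (step K τ b a z r) - (σ + a)))
        = Real.exp (l * (value τ b z - σ)) * A r.1 := by
      rw [value_step ha0, ← hk, ← he]
      simp only [hA]
      split_ifs <;> rw [← Real.exp_add] <;> push_cast <;> ring_nf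
    have h2 : ((2 : ℝ) ^ (step K τ b a z r).1)⁻¹ ≤ (2 ^ k)⁻¹ * J r.2 := by
      rw [step, if_neg ha0, ← hk]
      simp only [hJ]
      split_ifs with h3 h4 h4
      · simp only [pow_succ, mul_inv]; norm_num
      · simp only [pow_succ, mul_inv]
        have : (0 : ℝ) < (2 ^ k)⁻¹ := by positivity
        linarith
      · exact absurd (Or.inl h4) h3
      · simp
    have hA0 : 0 ≤ A r.1 := by simp only [hA]; split_ifs <;> positivity
    calc _ = Real.exp (l * (value τ b z - σ)) * A r.1 * (2 ^ (step K τ b a z r).1)⁻¹ := by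
          rw [h1, div_eq_mul_inv]
      _ ≤ Real.exp (l * (value τ b z - σ)) * A r.1 * ((2 ^ k)⁻¹ * J r.2) := by gcongr
      _ = c * (A r.1 * J r.2) := by rw [hc]; ring
  have heτ : e ≤ τ := by rw [he]; unfold unitExp; omega
  have hu : (1 : ℝ) ≤ 2 ^ e := one_le_pow₀ one_le_two
  have hlu : e ≠ 0 → l ^ 2 * 2 ^ e * 2 ^ e * 2 ^ b * (2 ^ k * 2 ^ k) * 2 ≤ 1 := by
    intro h
    have := two_pow_unitExp_of_pos h
    rw [← he] at this
    rw [← this] at hl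
    have hb : (0 : ℝ) < 2 ^ b := by positivity
    refine le_of_mul_le_mul_left ?_ hb
    nlinarith
  have hAs : ∑ r, A r ≤ 2 ^ (τ + K) * (1 + l ^ 2 * (2 ^ e - 1)) := by
    rw [hA, sum_bernoulli (by omega)]
    refine mul_le_mul_of_nonneg_left ?_ (by positivity)
    have := exp_moment_le (u := 2 ^ e) (y := l * a) hu (by
      by_cases h : e = 0
      · left; simp [h]
      · right
        rw [abs_mul, habs, mul_one]
        have h1 := hlu h
        have h2 : (1 : ℝ) ≤ 2 ^ b * (2 ^ k * 2 ^ k) * 2 := by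
          have : (1 : ℝ) ≤ 2 ^ b := one_le_pow₀ one_le_two
          have : (1 : ℝ) ≤ 2 ^ k := one_le_pow₀ one_le_two
          have : (1 : ℝ) ≤ 2 ^ k * 2 ^ k := by nlinarith
          nlinarith
        have h3 : (|l| * 2 ^ e) ^ 2 ≤ 1 := by
          rw [mul_pow, sq_abs]
          have : 0 ≤ l ^ 2 * 2 ^ e * 2 ^ e := by positivity
          nlinarith
        exact (sq_le_one_iff₀ (by positivity)).1 h3)
    rwa [mul_pow, ha2, mul_one] at this
  have hJs : (1 + l ^ 2 * (2 ^ e - 1)) * ∑ r, J r ≤ 2 ^ (τ + K) := by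
    by_cases hkK : k < K
    · have : ∑ r, J r = 2 ^ (τ + K) * (1 - (2 ^ (τ + k))⁻¹ / 2) := by
        have h1 := sum_bernoulli (Q := τ + K) (e := τ + k) (by omega) (1 / 2) 1
        have h2 : τ + K - (τ + k) = K - k := by omega
        rw [h2] at h1
        simp only [hJ, hkK, true_and]
        rw [h1]
        ring
      rw [this]
      have hρ : (0 : ℝ) < (2 ^ (τ + k))⁻¹ := by positivity
      have h3 : l ^ 2 * (2 ^ e - 1) ≤ (2 ^ (τ + k))⁻¹ / 2 := by
        by_cases h : e = 0
        · rw [h, pow_zero, sub_self, mul_zero]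
          positivity
        · have h1 := hlu h
          have h4 := two_pow_unitExp_of_pos h
          rw [← he] at h4
          have h5 : (2 ^ (τ + k) : ℝ)⁻¹ / 2 = (2 ^ e * 2 ^ b * (2 ^ k * 2 ^ k) * 2)⁻¹ := by
            rw [pow_add, ← h4, ← hk]
            field_simp
          rw [h5, inv_eq_one_div, le_div_iff₀ (by positivity)]
          refine le_trans ?_ h1
          have : 0 ≤ l ^ 2 * (2 ^ e * 2 ^ b * (2 ^ k * 2 ^ k) * 2) := by positivity
          nlinarith
      have h4 : 0 ≤ l ^ 2 * (2 ^ e - 1) := mul_nonneg (sq_nonneg l) (by linarith)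
      have h5 : (1 + l ^ 2 * (2 ^ e - 1)) * (1 - (2 ^ (τ + k))⁻¹ / 2) ≤ 1 := by nlinarith
      have h6 : (0 : ℝ) < 2 ^ (τ + K) := by positivity
      nlinarith
    · have : e = 0 := by rw [he]; unfold unitExp; omega
      simp [hJ, hkK, this]
  have hJ0 : 0 ≤ ∑ r, J r := Finset.sum_nonneg fun r _ => by
    simp only [hJ]; split_ifs <;> norm_num
  calc _ ≤ ∑ r : Seed (τ + K), c * (A r.1 * J r.2) := Finset.sum_le_sum fun r _ => hpt r
    _ = c * ((∑ r, A r) * ∑ r, J r) := by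
        rw [← Finset.mul_sum, Fintype.sum_prod_type, Finset.sum_mul_sum]
    _ ≤ c * (2 ^ (τ + K) * (1 + l ^ 2 * (2 ^ e - 1)) * ∑ r, J r) := by gcongr
    _ ≤ c * (2 ^ (τ + K) * 2 ^ (τ + K)) := by
        rw [mul_assoc]
        gcongr
    _ = _ := by rw [card_seed]; ring

/-- A potential dominating `2 ^ level`, unaffected by overflow-induced level increments. -/
def growth (τ b : ℕ) (z : ℕ × ℤ) : ℝ := max (2 ^ z.1) (|(value τ b z : ℝ)| / 2 ^ τ)

theorem le_two_pow_unitExp (τ b k : ℕ) : (2 : ℝ) ^ τ ≤ 2 ^ unitExp τ b k * 2 ^ b * 2 ^ k := by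
  rw [← pow_add, ← pow_add]
  refine pow_le_pow_right₀ one_le_two ?_
  unfold unitExp
  omega

theorem sum_growth_step_le {K τ b : ℕ} {a : ℤ} (ha : a = -1 ∨ a = 0 ∨ a = 1) (z : ℕ × ℤ) :
    ∑ r, growth τ b (step K τ b a z r)
      ≤ Fintype.card (Seed (τ + K)) *
        (growth τ b z + (if a = 0 then 0 else 1) * (2 / 2 ^ τ)) := by
  by_cases ha0 : a = 0
  · subst ha0
    simp [step]
  have habs : |(a : ℝ)| = 1 := by
    rcases ha with h | h | h
    · simp [h]
    · exact absurd h ha0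
    · simp [h]
  set e := unitExp τ b z.1 with he
  set k := z.1 with hk
  set A : Fin (2 ^ (τ + K)) → ℝ := fun r => if r.1 < 2 ^ (τ + K - e) then 2 ^ e / 2 ^ τ else 0
    with hA
  set J : Fin (2 ^ (τ + K)) → ℝ := fun r =>
    if k < K ∧ r.1 < 2 ^ (K - k) then 2 ^ k else 0 with hJ
  have hpt : ∀ r : Seed (τ + K),
      growth τ b (step K τ b a z r) ≤ growth τ b z + (A r.1 + J r.2) := by
    intro r
    have hA0 : 0 ≤ A r.1 := by simp only [hA]; split_ifs <;> positivity
    have hJ0 : 0 ≤ J r.2 := by simp only [hJ]; split_ifs <;> positivity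
    have hg1 : (2 : ℝ) ^ k ≤ growth τ b z := le_max_left _ _
    have hg2 : |(value τ b z : ℝ)| / 2 ^ τ ≤ growth τ b z := le_max_right _ _
    have hv : |(value τ b (step K τ b a z r) : ℝ)| / 2 ^ τ ≤ growth τ b z + A r.1 := by
      refine le_trans ?_ (add_le_add_left hg2 _)
      rw [value_step ha0]
      simp only [hA]
      split_ifs
      · rw [← add_div]
        gcongr
        push_cast
        refine (abs_add_le _ _).trans ?_
        rw [abs_mul, habs, abs_of_pos (by positivity : (0 : ℝ) < 2 ^ unitExp τ b z.1), one_mul]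
      · simp
    refine max_le ?_ (by linarith)
    by_cases hj : k < K ∧ r.2.1 < 2 ^ (K - k)
    · have : J r.2 = 2 ^ k := if_pos hj
      have h1 : (step K τ b a z r).1 = k + 1 := by
        rw [step, if_neg ha0, if_pos (Or.inl hj)]
      rw [h1, this, pow_succ]
      linarith
    · by_cases ho : 4 ^ z.1 * 2 ^ (b + 1) < |sampled K τ b a z r.1|
      · have h1 : step K τ b a z r = (z.1 + 1, sampled K τ b a z r.1 *
            2 ^ (unitExp τ b z.1 - unitExp τ b (z.1 + 1))) := by
          rw [step, if_neg ha0, if_pos (Or.inr ho)]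
        have h2 : value τ b (step K τ b a z r) = sampled K τ b a z r.1 * 2 ^ e := by
          have : unitExp τ b z.1 - unitExp τ b (z.1 + 1) + unitExp τ b (z.1 + 1)
              = unitExp τ b z.1 := by
            unfold unitExp; omega
          rw [h1]
          simp only [value, mul_assoc, ← pow_add, this]
          rfl
        have ho' : (4 : ℝ) ^ k * 2 ^ (b + 1) ≤ |(sampled K τ b a z r.1 : ℝ)| := by
          exact_mod_cast ho.le
        have h3 : (2 : ℝ) ^ (k + 1) ≤ |(value τ b (step K τ b a z r) : ℝ)| / 2 ^ τ := by
          rw [h2, le_div_iff₀ (by positivity)]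
          push_cast
          rw [abs_mul, abs_of_pos (by positivity : (0 : ℝ) < 2 ^ e)]
          calc (2 : ℝ) ^ (k + 1) * 2 ^ τ ≤ 2 ^ (k + 1) * (2 ^ e * 2 ^ b * 2 ^ k) := by
                gcongr
                exact le_two_pow_unitExp τ b k
            _ = 4 ^ k * 2 ^ (b + 1) * 2 ^ e := by
                rw [show (4 : ℝ) = 2 * 2 by norm_num, mul_pow]; ring
            _ ≤ _ := by gcongr
        have h4 : (step K τ b a z r).1 = k + 1 := by rw [h1]
        rw [h4]
        linarith
      · have h1 : (step K τ b a z r).1 = k := by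
          rw [step, if_neg ha0, if_neg (by tauto)]
        rw [h1]
        linarith
  have heτ : e ≤ τ := by rw [he]; unfold unitExp; omega
  have hAs : ∑ r, A r = 2 ^ (τ + K) * (1 / 2 ^ τ) := by
    rw [hA, sum_bernoulli (by omega)]
    field_simp
    ring
  have hJs : ∑ r, J r ≤ 2 ^ (τ + K) * (1 / 2 ^ τ) := by
    by_cases hkK : k < K
    · have h1 := sum_bernoulli (Q := τ + K) (e := τ + k) (by omega) (2 ^ k) 0
      have h2 : τ + K - (τ + k) = K - k := by omega
      rw [h2] at h1
      simp only [hJ, hkK, true_and]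
      rw [h1, pow_add 2 τ k]
      refine le_of_eq ?_
      field_simp
      ring
    · simp [hJ, hkK]
  calc _ ≤ ∑ r : Seed (τ + K), (growth τ b z + (A r.1 + J r.2)) :=
        Finset.sum_le_sum fun r _ => hpt r
    _ = 2 ^ (τ + K) * 2 ^ (τ + K) * growth τ b z + 2 ^ (τ + K) * ∑ r, A r
        + 2 ^ (τ + K) * ∑ r, J r := by
        rw [Finset.sum_add_distrib, Finset.sum_add_distrib]
        simp only [Fintype.sum_prod_type, Finset.sum_const, Finset.card_univ, Fintype.card_fin,
          nsmul_eq_mul, ← Finset.mul_sum, card_seed]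
        push_cast
        ring
    _ ≤ 2 ^ (τ + K) * 2 ^ (τ + K) * growth τ b z + 2 ^ (τ + K) * (2 ^ (τ + K) * (1 / 2 ^ τ))
        + 2 ^ (τ + K) * (2 ^ (τ + K) * (1 / 2 ^ τ)) := by
        rw [hAs]
        gcongr
    _ = _ := by rw [card_seed, if_neg ha0]; ring

/-- The memory states of the counter with `K + 1` levels. -/
def states (K b : ℕ) : Finset (ℕ × ℤ) :=
  (Finset.range (K + 1)).biUnion fun k =>
    {k} ×ˢ Finset.Icc (-(4 ^ k * 2 ^ (b + 1))) (4 ^ k * 2 ^ (b + 1))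

theorem mem_states {K b : ℕ} {z : ℕ × ℤ} :
    z ∈ states K b ↔ z.1 ≤ K ∧ |z.2| ≤ 4 ^ z.1 * 2 ^ (b + 1) := by
  simp only [states, Finset.mem_biUnion, Finset.mem_range, Finset.mem_product,
    Finset.mem_singleton, Finset.mem_Icc, abs_le]
  constructor
  · rintro ⟨k, hk, rfl, h⟩
    exact ⟨by omega, h⟩
  · rintro ⟨hk, h⟩
    exact ⟨z.1, by omega, rfl, h⟩

theorem zero_mem_states (K b : ℕ) : (0, 0) ∈ states K b := by
  rw [mem_states]
  simp

/-- The approximate counter as a streaming algorithm. -/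
def counter (n K τ b : ℕ) : OnePass (Fin n → Seed (τ + K)) (unif _) n where
  S := states K b
  fintS := inferInstance
  Rv := Seed (τ + K)
  fintR := inferInstance
  s0 := ⟨(0, 0), zero_mem_states K b⟩
  R := seed
  f _ a s r := if h : step K τ b a s.1 r ∈ states K b then ⟨_, h⟩ else ⟨(0, 0), zero_mem_states K b⟩
  out s := max (-n) (min n (value τ b s.1))
  indep := seed_indep

/-- The trajectory of the counter on the stream `x`. -/
def path {n : ℕ} (K τ b : ℕ) (x : ℕ → ℤ) : ℕ → (Fin n → Seed (τ + K)) → ℕ × ℤ :=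
  traj (fun j z r => step K τ b (x j) z r) (0, 0)

theorem step_mem_states {n K τ b j : ℕ} (hK : τ ≤ K) (hn : n ≤ 2 ^ K) (hj : j < n) {a : ℤ}
    (ha : a = -1 ∨ a = 0 ∨ a = 1) {z : ℕ × ℤ} (hz : z ∈ states K b)
    (hv : |value τ b z| ≤ j * 2 ^ K) (r : Seed (τ + K)) :
    step K τ b a z r ∈ states K b ∧ |value τ b (step K τ b a z r)| ≤ (j + 1 : ℕ) * 2 ^ K := by
  have hK0 : (0 : ℤ) < 2 ^ K := by positivity
  by_cases ha0 : a = 0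
  · subst ha0
    refine ⟨by simpa [step] using hz, ?_⟩
    simp only [step, if_true]
    push_cast
    linarith
  have habs : |a| = 1 := by
    rcases ha with rfl | rfl | rfl
    · simp
    · exact absurd rfl ha0
    · simp
  obtain ⟨hzK, hzm⟩ := mem_states.1 hz
  have hs : |sampled K τ b a z r.1| ≤ |z.2| + 1 := by
    unfold sampled
    split_ifs
    · exact habs ▸ abs_add_le _ _
    · linarith
  constructor
  · have hlt : (z.1 < K ∧ r.2.1 < 2 ^ (K - z.1)) ∨
        4 ^ z.1 * 2 ^ (b + 1) < |sampled K τ b a z r.1| → z.1 < K := by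
      rintro (h | h)
      · exact h.1
      · by_contra hlt
        have hzK' : z.1 = K := by omega
        have he : unitExp τ b z.1 = 0 := by unfold unitExp; omega
        rw [value, he, pow_zero, mul_one] at hv
        have h1 : ((j : ℤ) + 1) * 2 ^ K ≤ 2 ^ K * 2 ^ K := by
          have : (j : ℤ) + 1 ≤ 2 ^ K := by exact_mod_cast (Nat.succ_le_of_lt hj).trans hn
          gcongr
        have h2 : (2 : ℤ) ^ K * 2 ^ K = 4 ^ K := by rw [← mul_pow]; norm_num
        have h3 : (1 : ℤ) ≤ 2 ^ (b + 1) := one_le_pow₀ (by norm_num)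
        have h4 : (0 : ℤ) < 4 ^ K := by positivity
        rw [hzK'] at h
        nlinarith
    rw [step, if_neg ha0]
    split_ifs with h
    · have hk := hlt h
      rw [mem_states]
      refine ⟨hk, ?_⟩
      have hd : (2 : ℤ) ^ (unitExp τ b z.1 - unitExp τ b (z.1 + 1)) ≤ 2 ^ 1 :=
        pow_le_pow_right₀ (by norm_num) (by unfold unitExp; omega)
      simp only [abs_mul, abs_pow, abs_two]
      have h3 : (2 : ℤ) ≤ 2 ^ (b + 1) := by
        rw [pow_succ]; have : (1 : ℤ) ≤ 2 ^ b := one_le_pow₀ (by norm_num)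
        linarith
      have h4 : (1 : ℤ) ≤ 4 ^ z.1 := one_le_pow₀ (by norm_num)
      calc _ ≤ (4 ^ z.1 * 2 ^ (b + 1) + 1) * (2 : ℤ) ^ 1 := by
            gcongr
            linarith
        _ ≤ 4 ^ (z.1 + 1) * 2 ^ (b + 1) := by
            rw [pow_succ 4]
            nlinarith
    · rw [mem_states]
      push Not at h
      exact ⟨hzK, h.2⟩
  · rw [value_step ha0]
    have he : (2 : ℤ) ^ unitExp τ b z.1 ≤ 2 ^ K :=
      pow_le_pow_right₀ (by norm_num) (by unfold unitExp; omega)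
    push_cast
    split_ifs
    · refine (abs_add_le _ _).trans ?_
      rw [abs_mul, habs, abs_pow, abs_two]
      linarith
    · rw [add_zero]
      linarith

theorem path_mem_states {n K τ b : ℕ} (hK : τ ≤ K) (hn : n ≤ 2 ^ K) {x : ℕ → ℤ}
    (hx : ∀ j < n, x j = -1 ∨ x j = 0 ∨ x j = 1) (ω : Fin n → Seed (τ + K)) :
    ∀ j ≤ n, path K τ b x j ω ∈ states K b ∧ |value τ b (path K τ b x j ω)| ≤ j * 2 ^ K := by
  intro j
  induction j with
  | zero =>
    intro _
    exact ⟨zero_mem_states K b, by simp [path, traj, value]⟩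
  | succ j ih =>
    intro hj
    have hj' : j < n := hj
    obtain ⟨h1, h2⟩ := ih hj'.le
    have := step_mem_states hK hn hj' (hx j hj') h1 h2 (ω ⟨j, hj'⟩)
    simpa only [path, traj, hj', dif_pos] using this

theorem counter_run {n K τ b : ℕ} (hK : τ ≤ K) (hn : n ≤ 2 ^ K) {x : ℕ → ℤ}
    (hx : ∀ j < n, x j = -1 ∨ x j = 0 ∨ x j = 1) (ω : Fin n → Seed (τ + K)) :
    ∀ (j : ℕ) (hj : j ≤ n), (counter n K τ b).run x j ω =
      (⟨path K τ b x j ω, (path_mem_states hK hn hx ω j hj).1⟩ : states K b) := by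
  intro j
  induction j with
  | zero => intro _; rfl
  | succ j ih =>
    intro hj
    have hj' : j < n := hj
    have hm := (path_mem_states (b := b) hK hn hx ω (j + 1) hj).1
    have hp : path K τ b x (j + 1) ω = step K τ b (x j) (path K τ b x j ω) (ω ⟨j, hj'⟩) := by
      simp only [path, traj, hj', dif_pos]
    simp only [OnePass.run, hj', ih hj'.le]
    have hs : seed j ω = ω ⟨j, hj'⟩ := by simp [seed, hj']
    simp only [counter, hs, ← hp, hm, dif_pos]
    exact if_pos trivial

theorem abs_sum_le {n : ℕ} {x : ℕ → ℤ} (hx : ∀ j < n, x j = -1 ∨ x j = 0 ∨ x j = 1) :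
    |∑ j ∈ Finset.range n, (x j : ℝ)| ≤ n := by
  refine (Finset.abs_sum_le_sum_abs _ _).trans ?_
  calc _ ≤ ∑ j ∈ Finset.range n, (1 : ℝ) := Finset.sum_le_sum fun j hj => by
        rcases hx j (Finset.mem_range.1 hj) with h | h | h <;> simp [h]
    _ = n := by simp

theorem counter_abs_out_sub_le {n K τ b : ℕ} {x : ℕ → ℤ}
    (hx : ∀ j < n, x j = -1 ∨ x j = 0 ∨ x j = 1) (s : (counter n K τ b).S) :
    |(counter n K τ b).out s - ∑ j ∈ Finset.range n, (x j : ℝ)| ≤ 2 * n := by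
  have h := abs_le.1 (abs_sum_le hx)
  simp only [counter]
  have h1 := le_max_left (-(n : ℝ)) (min n (value τ b s.1))
  have h2 : max (-(n : ℝ)) (min n (value τ b s.1)) ≤ n :=
    max_le (by linarith) (min_le_left _ _)
  rw [abs_le]
  constructor <;> linarith

/-- Clamping to an interval containing `σ` does not increase the distance to `σ`. -/
theorem abs_clamp_sub_le {c v σ : ℝ} (h : |σ| ≤ c) : |max (-c) (min c v) - σ| ≤ |v - σ| := by
  obtain ⟨h1, h2⟩ := abs_le.1 h
  rcases le_total c v with hv | hv
  · rw [min_eq_left hv, max_eq_right (by linarith), abs_of_nonneg (by linarith),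
      abs_of_nonneg (by linarith)]
    linarith
  · rw [min_eq_right hv]
    rcases le_total (-c) v with hv' | hv'
    · rw [max_eq_right hv']
    · rw [max_eq_left hv', abs_of_nonpos (by linarith), abs_of_nonpos (by linarith)]
      linarith

theorem counter_accuracy {n K τ b : ℕ} (hK : τ ≤ K) (hn : n ≤ 2 ^ K) {l d : ℝ}
    (hl0 : 0 ≤ l) (hl : 2 * (l * 2 ^ τ) ^ 2 ≤ 2 ^ b) {x : ℕ → ℤ}
    (hx : ∀ j < n, x j = -1 ∨ x j = 0 ∨ x j = 1) :
    1 - 2 * 2 ^ K * Real.exp (-(l * d)) ≤ pr (unif (Fin n → Seed (τ + K))) (fun ω =>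
      |(counter n K τ b).out ((counter n K τ b).run x n ω) - ∑ j ∈ Finset.range n, (x j : ℝ)|
        ≤ d) := by
  set σ : ℕ → ℝ := fun j => ∑ i ∈ Finset.range j, (x i : ℝ) with hσ
  have hexp : ∀ l : ℝ, 2 * (l * 2 ^ τ) ^ 2 ≤ 2 ^ b →
      ∑ ω : Fin n → Seed (τ + K), Real.exp (l * (value τ b (path K τ b x n ω) - σ n)) /
        2 ^ (path K τ b x n ω).1 ≤ Fintype.card (Fin n → Seed (τ + K)) := by
    intro l hl
    have := sum_traj_le (fun j z r => step K τ b (x j) z r) (0, 0)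
      (fun j z => Real.exp (l * (value τ b z - σ j)) / 2 ^ z.1) (fun j hj z => by
        simp only [hσ, Finset.sum_range_succ]
        exact sum_exp_step_le hK hl (hx j hj) _ z) n le_rfl
    simpa [value, hσ, path] using this
  have hcard : (0 : ℝ) < Fintype.card (Fin n → Seed (τ + K)) := by
    exact_mod_cast Fintype.card_pos
  have hpt : ∀ ω : Fin n → Seed (τ + K),
      unif (Fin n → Seed (τ + K)) ω - 2 ^ K * Real.exp (-(l * d)) *
        (unif (Fin n → Seed (τ + K)) ω *
          (Real.exp (l * (value τ b (path K τ b x n ω) - σ n)) / 2 ^ (path K τ b x n ω).1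
          + Real.exp (-l * (value τ b (path K τ b x n ω) - σ n)) / 2 ^ (path K τ b x n ω).1))
      ≤ if |(counter n K τ b).out ((counter n K τ b).run x n ω) - σ n| ≤ d
          then unif (Fin n → Seed (τ + K)) ω else 0 := by
    intro ω
    have hu : 0 ≤ unif (Fin n → Seed (τ + K)) ω := (isPMF_unif _).nonneg ω
    set z := path K τ b x n ω with hz
    split_ifs with hg
    · have : 0 ≤ 2 ^ K * Real.exp (-(l * d)) * (unif (Fin n → Seed (τ + K)) ω *
          (Real.exp (l * (value τ b z - σ n)) / 2 ^ z.1
          + Real.exp (-l * (value τ b z - σ n)) / 2 ^ z.1)) := by positivity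
      linarith
    · rw [counter_run hK hn hx ω n le_rfl] at hg
      have hd : d ≤ |(value τ b z : ℝ) - σ n| := by
        refine (not_le.1 hg).le.trans ?_
        exact abs_clamp_sub_le (abs_sum_le hx)
      have hzK : z.1 ≤ K := (mem_states.1 (path_mem_states (b := b) hK hn hx ω n le_rfl).1).1
      have h1 : Real.exp (l * d) ≤ Real.exp (l * (value τ b z - σ n))
          + Real.exp (-l * (value τ b z - σ n)) := by
        rcases abs_cases ((value τ b z : ℝ) - σ n) with ⟨h, _⟩ | ⟨h, _⟩
        · have : Real.exp (l * d) ≤ Real.exp (l * (value τ b z - σ n)) := by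
            rw [← h]; gcongr
          have := Real.exp_pos (-l * (value τ b z - σ n))
          linarith
        · have : Real.exp (l * d) ≤ Real.exp (-l * (value τ b z - σ n)) := by
            rw [neg_mul_comm, ← h]; gcongr
          have := Real.exp_pos (l * (value τ b z - σ n))
          linarith
      have h2 : (2 : ℝ) ^ z.1 ≤ 2 ^ K := pow_le_pow_right₀ one_le_two hzK
      have h3 : 1 ≤ 2 ^ K * Real.exp (-(l * d)) * (Real.exp (l * (value τ b z - σ n)) / 2 ^ z.1
          + Real.exp (-l * (value τ b z - σ n)) / 2 ^ z.1) := by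
        rw [← add_div, mul_div_assoc', le_div_iff₀ (by positivity), one_mul]
        calc (2 : ℝ) ^ z.1 ≤ 2 ^ K := h2
          _ = 2 ^ K * Real.exp (-(l * d)) * Real.exp (l * d) := by
              rw [mul_assoc, ← Real.exp_add]; simp
          _ ≤ _ := by gcongr
      nlinarith
  have hsum := Finset.sum_le_sum fun ω (_ : ω ∈ Finset.univ) => hpt ω
  refine le_trans ?_ hsum
  have e1 := hexp l hl
  have e2 := hexp (-l) (by rwa [neg_mul, neg_sq])
  rw [Finset.sum_sub_distrib, (isPMF_unif _).sum_one, ← Finset.mul_sum]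
  simp only [unif, ← Finset.mul_sum, Finset.sum_add_distrib]
  have : (Fintype.card (Fin n → Seed (τ + K)) : ℝ)⁻¹ *
      (∑ ω : Fin n → Seed (τ + K), Real.exp (l * (value τ b (path K τ b x n ω) - σ n)) /
        2 ^ (path K τ b x n ω).1 +
      ∑ ω : Fin n → Seed (τ + K), Real.exp (-l * (value τ b (path K τ b x n ω) - σ n)) /
        2 ^ (path K τ b x n ω).1) ≤ 2 := by
    rw [inv_mul_le_iff₀ hcard]
    linarith
  have h0 : (0 : ℝ) ≤ 2 ^ K * Real.exp (-(l * d)) := by positivity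
  nlinarith

theorem counter_level {n K τ b : ℕ} {x : ℕ → ℤ}
    (hx : ∀ j < n, x j = -1 ∨ x j = 0 ∨ x j = 1) {j : ℕ} (hj : j ≤ n) :
    ∑ ω, unif (Fin n → Seed (τ + K)) ω * 2 ^ (path K τ b x j ω).1
      ≤ 1 + (∑ i ∈ Finset.range j, if x i = 0 then (0 : ℝ) else 1) * (2 / 2 ^ τ) := by
  set N : ℕ → ℝ := fun j => ∑ i ∈ Finset.range j, if x i = 0 then (0 : ℝ) else 1 with hN
  have hcard : (0 : ℝ) < Fintype.card (Fin n → Seed (τ + K)) := by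
    exact_mod_cast Fintype.card_pos
  have h := sum_traj_le (fun j z r => step K τ b (x j) z r) (0, 0)
    (fun j z => growth τ b z - N j * (2 / 2 ^ τ)) (fun j hj z => by
      have := sum_growth_step_le (K := K) (τ := τ) (b := b) (hx j hj) z
      simp only [hN, Finset.sum_range_succ, Finset.sum_sub_distrib, Finset.sum_const,
        Finset.card_univ, nsmul_eq_mul]
      refine (sub_le_sub_right this _).trans (le_of_eq ?_)
      ring) j hj
  have h0 : growth τ b (0, 0) - N 0 * (2 / 2 ^ τ) = 1 := by simp [growth, hN, value]
  rw [h0, Finset.sum_sub_distrib] at h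
  simp only [Finset.sum_const, Finset.card_univ, nsmul_eq_mul] at h
  simp only [unif, ← Finset.mul_sum]
  rw [inv_mul_le_iff₀ hcard]
  have : ∑ ω : Fin n → Seed (τ + K), (2 : ℝ) ^ (path K τ b x j ω).1
      ≤ ∑ ω : Fin n → Seed (τ + K), growth τ b (path K τ b x j ω) :=
    Finset.sum_le_sum fun ω _ => le_max_left _ _
  unfold path at *
  linarith

theorem ext3_mem {n : ℕ} (y : Fin n → Fin 3) (j : ℕ) :
    ext3 n y j = -1 ∨ ext3 n y j = 0 ∨ ext3 n y j = 1 := by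
  unfold ext3
  split_ifs with h
  · have := (y ⟨j, h⟩).2
    omega
  · simp

theorem isPMF_prod {Ω Ω' : Type} [Fintype Ω] [Fintype Ω'] {p : Ω → ℝ} {D : Ω' → ℝ}
    (hp : IsPMF p) (hD : IsPMF D) : IsPMF (fun q : Ω × Ω' => p q.1 * D q.2) where
  nonneg q := mul_nonneg (hp.nonneg _) (hD.nonneg _)
  sum_one := by
    rw [Fintype.sum_prod_type, ← Finset.sum_mul_sum, hp.sum_one, hD.sum_one, one_mul]

/-- The probability assigned by a code to a memory state. -/
def codeWeight (K b : ℕ) (z : ℕ × ℤ) : ℝ := ((K + 1) * (2 * (4 ^ z.1 * 2 ^ (b + 1)) + 1))⁻¹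

theorem sum_codeWeight (K b : ℕ) : ∑ s : states K b, codeWeight K b s.1 = 1 := by
  rw [Finset.sum_coe_sort (states K b) (codeWeight K b),
    Finset.sum_finset_product (states K b) (Finset.range (K + 1))
      (fun k => Finset.Icc (-(4 ^ k * 2 ^ (b + 1))) (4 ^ k * 2 ^ (b + 1)))
      (fun z => by rw [mem_states, Finset.mem_range, Finset.mem_Icc, abs_le, Nat.lt_succ_iff])]
  have : ∀ k : ℕ, ∑ m ∈ Finset.Icc (-(4 ^ k * 2 ^ (b + 1)) : ℤ) (4 ^ k * 2 ^ (b + 1)),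
      codeWeight K b (k, m) = ((K : ℝ) + 1)⁻¹ := by
    intro k
    simp only [codeWeight, Finset.sum_const, Int.card_Icc, nsmul_eq_mul]
    have h : (((4 ^ k * 2 ^ (b + 1) + 1 - -(4 ^ k * 2 ^ (b + 1)) : ℤ).toNat : ℕ) : ℝ)
        = 2 * (4 ^ k * 2 ^ (b + 1)) + 1 := by
      have h0 : (0 : ℤ) ≤ 4 ^ k * 2 ^ (b + 1) + 1 - -(4 ^ k * 2 ^ (b + 1)) := by
        have : (0 : ℤ) ≤ 4 ^ k * 2 ^ (b + 1) := by positivity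
        linarith
      have := congrArg (Int.cast : ℤ → ℝ) (Int.toNat_of_nonneg h0)
      push_cast at this
      rw [this]
      ring
    rw [h]
    field_simp
  rw [Finset.sum_congr rfl fun k _ => this k]
  simp
  field_simp

theorem codeLength_le {K b : ℕ} {c : ℝ} (hc : 0 < c) (z : ℕ × ℤ) :
    -Real.logb 2 (codeWeight K b z)
      ≤ Real.logb 2 (K + 1) + b + 3 + 2 * (Real.logb 2 c + 2 ^ z.1 / c) := by
  have hk : (z.1 : ℝ) ≤ Real.logb 2 c + 2 ^ z.1 / c := by
    have h1 : (z.1 : ℝ) = Real.logb 2 c + Real.logb 2 (2 ^ z.1 / c) := by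
      rw [← Real.logb_mul hc.ne' (by positivity), mul_div_cancel₀ _ hc.ne', Real.logb_pow]
      simp
    have h2 : Real.logb 2 (2 ^ z.1 / c) ≤ 2 ^ z.1 / c := by
      set y : ℝ := 2 ^ z.1 / c
      have hy : 0 < y := by positivity
      have h3 := Real.log_le_sub_one_of_pos (half_pos hy)
      rw [Real.log_div hy.ne' two_ne_zero] at h3
      have h4 := Real.log_two_gt_d9
      have h5 := Real.log_two_lt_d9
      rw [Real.logb, div_le_iff₀ (by linarith)]
      nlinarith
    linarith
  have h2 : Real.logb 2 (2 * (4 ^ z.1 * 2 ^ (b + 1)) + 1) ≤ 2 * z.1 + b + 3 := by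
    rw [Real.logb_le_iff_le_rpow one_lt_two (by positivity)]
    have : (2 : ℝ) ^ (2 * (z.1 : ℝ) + b + 3) = 4 ^ z.1 * 2 ^ (b + 1) * 4 := by
      rw [show (2 * (z.1 : ℝ) + b + 3) = ((2 * z.1 + b + 3 : ℕ) : ℝ) by push_cast; ring,
        Real.rpow_natCast, pow_add, pow_add, pow_mul]
      norm_num
      ring
    rw [this]
    have : (1 : ℝ) ≤ 4 ^ z.1 := one_le_pow₀ (by norm_num)
    have : (1 : ℝ) ≤ 2 ^ (b + 1) := one_le_pow₀ (by norm_num)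
    nlinarith
  rw [codeWeight, Real.logb_inv, neg_neg, Real.logb_mul (by positivity) (by positivity)]
  linarith

theorem counter_entropy {n K τ b : ℕ} (hK : τ ≤ K) (hn : n ≤ 2 ^ K) {B c : ℝ} (hc : 0 < c)
    (hB : 1 + B * (2 / 2 ^ τ) ≤ c) {D : (Fin n → Fin 3) → ℝ} (hD : IsPMF D)
    (hDB : (∑ x : Fin n → Fin 3, D x *
      ((Finset.univ.filter (fun j : Fin n => ext3 n x j.1 ≠ 0)).card : ℝ)) ≤ B)
    {j : ℕ} (hj : j ≤ n) :
    H (fun ωx : (Fin n → Seed (τ + K)) × (Fin n → Fin 3) =>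
        unif (Fin n → Seed (τ + K)) ωx.1 * D ωx.2)
      (fun ωx => (counter n K τ b).run (ext3 n ωx.2) j ωx.1)
      ≤ Real.logb 2 (K + 1) + b + 5 + 2 * Real.logb 2 c := by
  have hu := isPMF_unif (Fin n → Seed (τ + K))
  refine (H_le_of_kraft (isPMF_prod hu hD) _
    (fun s : (counter n K τ b).S => codeWeight K b s.1)
    (fun s => by unfold codeWeight; positivity) (sum_codeWeight K b).le).trans ?_
  have hlen : ∀ (y : Fin n → Fin 3), ∑ ω, unif (Fin n → Seed (τ + K)) ω *
      -Real.logb 2 (codeWeight K b ((counter n K τ b).run (ext3 n y) j ω).1)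
      ≤ Real.logb 2 (K + 1) + b + 3 + 2 * (Real.logb 2 c + (1 +
        ((Finset.univ.filter (fun j : Fin n => ext3 n y j.1 ≠ 0)).card : ℝ) * (2 / 2 ^ τ)) / c) := by
    intro y
    have hy : ∀ j < n, ext3 n y j = -1 ∨ ext3 n y j = 0 ∨ ext3 n y j = 1 :=
      fun j _ => ext3_mem y j
    have hN : (∑ i ∈ Finset.range j, if ext3 n y i = 0 then (0 : ℝ) else 1)
        ≤ (Finset.univ.filter (fun j : Fin n => ext3 n y j.1 ≠ 0)).card := by
      calc _ ≤ ∑ i ∈ Finset.range n, if ext3 n y i = 0 then (0 : ℝ) else 1 :=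
            Finset.sum_le_sum_of_subset_of_nonneg (Finset.range_mono hj)
              fun i _ _ => by split_ifs <;> norm_num
        _ = _ := by
            rw [← Fin.sum_univ_eq_sum_range (fun i => if ext3 n y i = 0 then (0 : ℝ) else 1),
              Finset.card_filter]
            push_cast
            refine Finset.sum_congr rfl fun i _ => ?_
            by_cases h : ext3 n y i.1 = 0 <;> simp [h]
    have hlev := (counter_level (K := K) (τ := τ) (b := b) hy hj).trans
      (add_le_add_right (mul_le_mul_of_nonneg_right hN (by positivity)) 1)
    calc _ ≤ ∑ ω, unif (Fin n → Seed (τ + K)) ω * (Real.logb 2 (K + 1) + b + 3 +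
            2 * (Real.logb 2 c + 2 ^ (path K τ b (ext3 n y) j ω).1 / c)) := by
          refine Finset.sum_le_sum fun ω _ => mul_le_mul_of_nonneg_left ?_ (hu.nonneg ω)
          rw [counter_run hK hn hy ω j hj]
          exact codeLength_le hc _
      _ = Real.logb 2 (K + 1) + b + 3 + 2 * (Real.logb 2 c +
            (∑ ω, unif (Fin n → Seed (τ + K)) ω * 2 ^ (path K τ b (ext3 n y) j ω).1) / c) := by
          simp only [mul_add, Finset.sum_add_distrib, ← Finset.sum_mul, hu.sum_one, one_mul,
            Finset.sum_div, Finset.mul_sum]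
          congr 2
          refine Finset.sum_congr rfl fun ω _ => ?_
          ring
      _ ≤ _ := by gcongr
  rw [Fintype.sum_prod_type_right]
  calc _ = ∑ y, D y * ∑ ω, unif (Fin n → Seed (τ + K)) ω *
        -Real.logb 2 (codeWeight K b ((counter n K τ b).run (ext3 n y) j ω).1) := by
        simp only [Finset.mul_sum]
        refine Finset.sum_congr rfl fun y _ => Finset.sum_congr rfl fun ω _ => ?_
        ring
    _ ≤ ∑ y, D y * (Real.logb 2 (K + 1) + b + 3 + 2 * (Real.logb 2 c + (1 +
        ((Finset.univ.filter (fun j : Fin n => ext3 n y j.1 ≠ 0)).card : ℝ) * (2 / 2 ^ τ)) / c)) :=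
        Finset.sum_le_sum fun y _ => mul_le_mul_of_nonneg_left (hlen y) (hD.nonneg y)
    _ = Real.logb 2 (K + 1) + b + 3 + 2 * (Real.logb 2 c + (1 + (∑ y, D y *
        ((Finset.univ.filter (fun j : Fin n => ext3 n y j.1 ≠ 0)).card : ℝ)) *
          (2 / 2 ^ τ)) / c) := by
        have h : ∀ y, D y * (Real.logb 2 (K + 1) + b + 3 + 2 * (Real.logb 2 c + (1 +
            ((Finset.univ.filter (fun j : Fin n => ext3 n y j.1 ≠ 0)).card : ℝ) *
              (2 / 2 ^ τ)) / c))
            = D y * (Real.logb 2 (K + 1) + b + 3 + 2 * (Real.logb 2 c + 1 / c)) + D y *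
            ((Finset.univ.filter (fun j : Fin n => ext3 n y j.1 ≠ 0)).card : ℝ) *
              (2 * (2 / 2 ^ τ) / c) := fun y => by ring
        rw [Finset.sum_congr rfl fun y _ => h y, Finset.sum_add_distrib, ← Finset.sum_mul,
          ← Finset.sum_mul, hD.sum_one]
        ring
    _ ≤ Real.logb 2 (K + 1) + b + 3 + 2 * (Real.logb 2 c + 1) := by
        gcongr
        rw [div_le_one hc]
        refine le_trans ?_ hB
        gcongr
    _ = _ := by ring

/-- A counter with additive error `T / 2` and small entropy, simultaneously for all bounds `B` on
the expected number of nonzero inputs. -/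
theorem exists_counter {n : ℕ} (hn : 4 ≤ n) {T : ℝ} (hT : 4 ≤ T) (hTn : T ≤ 2 * n) :
    ∃ K τ b : ℕ,
      (∀ x : ℕ → ℤ, (∀ j < n, x j = -1 ∨ x j = 0 ∨ x j = 1) →
        1 - 1 / (n : ℝ) ^ 3 ≤ pr (unif (Fin n → Seed (τ + K))) (fun ω =>
          |(counter n K τ b).out ((counter n K τ b).run x n ω) -
            ∑ j ∈ Finset.range n, (x j : ℝ)| ≤ T / 2)) ∧
      ∀ B : ℝ, T ≤ B → ∀ D : (Fin n → Fin 3) → ℝ, IsPMF D →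
        (∑ x : Fin n → Fin 3, D x *
          ((Finset.univ.filter (fun j : Fin n => ext3 n x j.1 ≠ 0)).card : ℝ)) ≤ B →
        ∀ j ≤ n, H (fun ωx : (Fin n → Seed (τ + K)) × (Fin n → Fin 3) =>
            unif (Fin n → Seed (τ + K)) ωx.1 * D ωx.2)
          (fun ωx => (counter n K τ b).run (ext3 n ωx.2) j ωx.1)
          ≤ 40 + 6 * Real.logb 2 (Real.logb 2 n) + 2 * Real.logb 2 (B / T) := by
  have hn0 : n ≠ 0 := by omega
  obtain ⟨K, hK1, hnK, hKn⟩ : ∃ K, 1 ≤ K ∧ n < 2 ^ K ∧ 2 ^ K ≤ 2 * n := by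
    refine ⟨Nat.log 2 n + 1, by omega, Nat.lt_pow_succ_log_self one_lt_two n, ?_⟩
    have := Nat.pow_log_le_self 2 hn0
    rw [pow_succ]
    omega
  obtain ⟨τ, hτ1, hτ2⟩ : ∃ τ : ℕ, (2 : ℝ) ^ τ ≤ T ∧ T < 2 ^ (τ + 1) := by
    have hfl : ⌊T⌋₊ ≠ 0 := by
      have : 4 ≤ ⌊T⌋₊ := Nat.le_floor (by exact_mod_cast hT)
      omega
    refine ⟨Nat.log 2 ⌊T⌋₊, ?_, ?_⟩
    · refine le_trans ?_ (Nat.floor_le (by linarith : (0 : ℝ) ≤ T))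
      exact_mod_cast Nat.pow_log_le_self 2 hfl
    · refine (Nat.lt_floor_add_one T).trans_le ?_
      exact_mod_cast Nat.succ_le_of_lt (Nat.lt_pow_succ_log_self one_lt_two ⌊T⌋₊)
  obtain ⟨b, hb1, hb2⟩ : ∃ b : ℕ, 200 * K ^ 2 ≤ 2 ^ b ∧ 2 ^ b ≤ 400 * K ^ 2 := by
    refine ⟨Nat.clog 2 (200 * K ^ 2), Nat.le_pow_clog one_lt_two _, ?_⟩
    have h1 : 1 < 200 * K ^ 2 := by nlinarith
    have h2 := Nat.pow_pred_clog_lt_self one_lt_two h1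
    have h3 : 0 < Nat.clog 2 (200 * K ^ 2) := Nat.clog_pos one_lt_two (by omega)
    obtain ⟨m, hm⟩ := Nat.exists_eq_succ_of_ne_zero h3.ne'
    rw [hm] at h2 ⊢
    simp only [Nat.pred_eq_sub_one, Nat.succ_eq_add_one, Nat.add_sub_cancel] at h2
    rw [pow_succ]
    omega
  have hτK : τ ≤ K := by
    have : (2 : ℝ) ^ τ < 2 ^ (K + 1) := by
      have : (n : ℝ) < 2 ^ K := by exact_mod_cast hnK
      rw [pow_succ]
      linarith
    have := (pow_lt_pow_iff_right₀ one_lt_two).1 this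
    omega
  have hnR : (4 : ℝ) ≤ n := by exact_mod_cast hn
  have hτ0 : (0 : ℝ) < 2 ^ τ := by positivity
  refine ⟨K, τ, b, ?_, ?_⟩
  · intro x hx
    have hl : 2 * (10 * (K : ℝ) / 2 ^ τ * 2 ^ τ) ^ 2 ≤ 2 ^ b := by
      rw [div_mul_cancel₀ _ hτ0.ne']
      have : (200 * K ^ 2 : ℝ) ≤ 2 ^ b := by exact_mod_cast hb1
      linarith
    refine le_trans ?_ (counter_accuracy (d := T / 2) hτK hnK.le (by positivity) hl hx)
    have h1 : 5 * (K : ℝ) ≤ 10 * (K : ℝ) / 2 ^ τ * (T / 2) := by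
      rw [div_mul_eq_mul_div, le_div_iff₀ hτ0]
      nlinarith [(Nat.cast_nonneg K : (0 : ℝ) ≤ K)]
    have h2 : Real.exp (-(10 * (K : ℝ) / 2 ^ τ * (T / 2))) ≤ ((2 ^ K) ^ 5)⁻¹ := by
      rw [Real.exp_neg]
      refine inv_anti₀ (by positivity) (le_trans ?_ (Real.exp_le_exp.2 h1))
      have h3 : (2 : ℝ) ≤ Real.exp 1 := by
        have := Real.add_one_le_exp (1 : ℝ)
        linarith
      rw [← pow_mul, show 5 * (K : ℝ) = ((K * 5 : ℕ) : ℝ) * 1 by push_cast; ring, Real.exp_nat_mul]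
      gcongr
    have hN : (n : ℝ) ≤ 2 ^ K := by exact_mod_cast hnK.le
    have h3 : 2 * 2 ^ K * Real.exp (-(10 * (K : ℝ) / 2 ^ τ * (T / 2))) ≤ 1 / (n : ℝ) ^ 3 := by
      calc _ ≤ 2 * 2 ^ K * (((2 : ℝ) ^ K) ^ 5)⁻¹ := by gcongr
        _ = 2 / ((2 : ℝ) ^ K) ^ 4 := by field_simp
        _ ≤ 2 / (n : ℝ) ^ 4 := by gcongr
        _ ≤ 1 / (n : ℝ) ^ 3 := by
            rw [div_le_div_iff₀ (by positivity) (by positivity)]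
            have : (0 : ℝ) < (n : ℝ) ^ 3 := by positivity
            nlinarith
    linarith
  · intro B hTB D hD hDB j hj
    have hc : 0 < 5 * (B / T) := by
      have : 0 < B / T := div_pos (by linarith) (by linarith)
      linarith
    have hBT : 1 ≤ B / T := (one_le_div (by linarith)).2 hTB
    have hBc : 1 + B * (2 / 2 ^ τ) ≤ 5 * (B / T) := by
      have : B * (2 / 2 ^ τ) ≤ 4 * (B / T) := by
        rw [mul_div_assoc', mul_div_assoc', div_le_div_iff₀ hτ0 (by linarith)]
        rw [pow_succ] at hτ2
        nlinarith
      linarith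
    refine (counter_entropy hτK hnK.le hc hBc hD hDB hj).trans ?_
    set ℓ := Real.logb 2 n with hℓ
    have hℓ2 : 2 ≤ ℓ := by
      rw [hℓ, Real.le_logb_iff_rpow_le one_lt_two (by linarith)]
      norm_num
      exact_mod_cast hn
    have hKℓ : (K : ℝ) ≤ ℓ + 1 := by
      have h1 : ((2 : ℝ) ^ K) ≤ 2 * n := by exact_mod_cast hKn
      have h2 := Real.logb_le_logb_of_le one_lt_two (by positivity) h1
      rw [Real.logb_pow, Real.logb_mul two_ne_zero (by positivity),
        Real.logb_self_eq_one one_lt_two] at h2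
      linarith
    have hK0 : (0 : ℝ) < K := by exact_mod_cast hK1
    have h2ℓ : Real.logb 2 (2 * ℓ) = 1 + Real.logb 2 ℓ := by
      rw [Real.logb_mul two_ne_zero (by linarith), Real.logb_self_eq_one one_lt_two]
    have e1 : Real.logb 2 (K + 1) ≤ 1 + Real.logb 2 ℓ := by
      rw [← h2ℓ]
      exact Real.logb_le_logb_of_le one_lt_two (by positivity) (by linarith)
    have e2 : Real.logb 2 K ≤ 1 + Real.logb 2 ℓ := by
      rw [← h2ℓ]
      exact Real.logb_le_logb_of_le one_lt_two hK0 (by linarith)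
    have e3 : (b : ℝ) ≤ 9 + 2 * Real.logb 2 K := by
      have h1 : (2 : ℝ) ^ b ≤ 2 ^ 9 * K ^ 2 := by
        have : (2 : ℝ) ^ b ≤ 400 * K ^ 2 := by exact_mod_cast hb2
        nlinarith
      have h2 := Real.logb_le_logb_of_le one_lt_two (by positivity) h1
      rw [Real.logb_mul (by positivity) (by positivity), Real.logb_pow, Real.logb_pow,
        Real.logb_pow, Real.logb_self_eq_one one_lt_two] at h2
      push_cast at h2
      linarith
    have e4 : Real.logb 2 (5 * (B / T)) ≤ 3 + Real.logb 2 (B / T) := by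
      have h1 : 5 * (B / T) ≤ 2 ^ 3 * (B / T) := by linarith
      have h2 := Real.logb_le_logb_of_le one_lt_two hc h1
      rw [Real.logb_mul (x := 2 ^ 3) (by positivity) (by linarith), Real.logb_pow,
        Real.logb_self_eq_one one_lt_two] at h2
      push_cast at h2
      linarith
    have e5 : 0 ≤ Real.logb 2 ℓ := Real.logb_nonneg one_lt_two (by linarith)
    linarith

/-- A bound on the second moment of a bounded random variable that is small with high
probability. -/
theorem sum_sq_le {Ω : Type} [Fintype Ω] {p : Ω → ℝ} (hp : IsPMF p) {Z : Ω → ℝ} {d M δ : ℝ}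
    (hd : 1 - δ ≤ pr p (fun ω => |Z ω| ≤ d)) (hM : ∀ ω, |Z ω| ≤ M) :
    ∑ ω, p ω * Z ω ^ 2 ≤ d ^ 2 + M ^ 2 * δ := by
  have hpt : ∀ ω, p ω * Z ω ^ 2 ≤ p ω * d ^ 2 +
      M ^ 2 * (p ω - if |Z ω| ≤ d then p ω else 0) := by
    intro ω
    have h := hp.nonneg ω
    have hM2 : Z ω ^ 2 ≤ M ^ 2 := by
      rw [← sq_abs]
      exact pow_le_pow_left₀ (abs_nonneg _) (hM ω) 2
    split_ifs with hz
    · have : Z ω ^ 2 ≤ d ^ 2 := by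
        rw [← sq_abs]
        exact pow_le_pow_left₀ (abs_nonneg _) hz 2
      rw [sub_self, mul_zero, add_zero]
      gcongr
    · have h1 : p ω * Z ω ^ 2 ≤ p ω * M ^ 2 := by gcongr
      have h2 : 0 ≤ p ω * d ^ 2 := by positivity
      linarith
  refine (Finset.sum_le_sum fun ω _ => hpt ω).trans ?_
  rw [Finset.sum_add_distrib, ← Finset.sum_mul, hp.sum_one, one_mul, ← Finset.mul_sum,
    Finset.sum_sub_distrib, hp.sum_one]
  have : M ^ 2 * (1 - pr p (fun ω => |Z ω| ≤ d)) ≤ M ^ 2 * δ := by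
    gcongr
    linarith
  unfold pr at this
  linarith

/-- Propositions `cl:aprsum` and `cl:aprinf`, the algorithm `Apr`:
for all `n ≥ 4` and all reals `γ > 4/√n` and `B > γ·√n`, there is a one-pass streaming
algorithm `Apr` on input streams `a ∈ {-1,0,1}^n` such that:
(i) for every fixed input, with probability at least `1 - 1/n³` over the private
randomness, `|output − Σ_j a_j| ≤ (γ/2)·√n`; consequently for every input distribution
`D` on `{-1,0,1}^n`, `E[(output − Σ_j a_j)²] ≤ γ²·n`; and
(ii) for every input distribution `D` on `{-1,0,1}^n` with expected number of nonzero
entries at most `B`, every memory state has entropy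
`H(Apr_j) ≤ 40 + 6·log₂ log₂ n + 2·log₂(B/(γ·√n))` (entropy over both the random input
and the private randomness). -/
theorem approximate_sum_algorithm :
    ∀ n : ℕ, 4 ≤ n → ∀ γ B : ℝ, 4 / Real.sqrt n < γ → γ * Real.sqrt n < B →
      ∃ (Ω : Type) (_ : Fintype Ω) (p : Ω → ℝ), IsPMF p ∧
        ∃ A : OnePass Ω p n,
          -- (i) worst-case additive-error guarantee:
          (∀ x : ℕ → ℤ, (∀ j < n, x j = -1 ∨ x j = 0 ∨ x j = 1) →
            1 - 1 / (n : ℝ) ^ 3 ≤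
              pr p (fun ω =>
                |A.out (A.run x n ω) - ∑ j ∈ Finset.range n, (x j : ℝ)| ≤
                  γ / 2 * Real.sqrt n)) ∧
          -- (i) consequence: squared-error guarantee for every input distribution:
          (∀ D : (Fin n → Fin 3) → ℝ, IsPMF D →
            ∑ x : Fin n → Fin 3, D x *
                (∑ ω, p ω *
                  (A.out (A.run (ext3 n x) n ω) -
                    ∑ j ∈ Finset.range n, (ext3 n x j : ℝ)) ^ 2)
              ≤ γ ^ 2 * n) ∧
          -- (ii) low-entropy guarantee:
          (∀ D : (Fin n → Fin 3) → ℝ, IsPMF D →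
            (∑ x : Fin n → Fin 3, D x *
                ((Finset.univ.filter (fun j : Fin n => ext3 n x j.1 ≠ 0)).card : ℝ)) ≤ B →
            ∀ j ≤ n,
              H (fun ωx : Ω × (Fin n → Fin 3) => p ωx.1 * D ωx.2)
                  (fun ωx => A.run (ext3 n ωx.2) j ωx.1)
                ≤ 40 + 6 * Real.logb 2 (Real.logb 2 n) +
                    2 * Real.logb 2 (B / (γ * Real.sqrt n))) := by
  intro n hn γ B hγ hB
  have hn0 : (0 : ℝ) < n := by exact_mod_cast (by omega : 0 < n)
  have hnR : (4 : ℝ) ≤ n := by exact_mod_cast hn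
  have hs : 0 < Real.sqrt n := Real.sqrt_pos.2 hn0
  set T := γ * Real.sqrt n with hT
  have hT4 : 4 < T := (div_lt_iff₀ hs).1 hγ
  have hT2 : T ^ 2 = γ ^ 2 * n := by rw [hT, mul_pow, Real.sq_sqrt hn0.le]
  have hhalf : γ / 2 * Real.sqrt n = T / 2 := by rw [hT]; ring
  rw [hhalf]
  obtain ⟨K, τ, b, hacc, hent⟩ :=
    exists_counter hn (T := min T (2 * n)) (le_min hT4.le (by linarith)) (min_le_right _ _)
  have hacc' : ∀ x : ℕ → ℤ, (∀ j < n, x j = -1 ∨ x j = 0 ∨ x j = 1) →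
      1 - 1 / (n : ℝ) ^ 3 ≤ pr (unif (Fin n → Seed (τ + K))) (fun ω =>
        |(counter n K τ b).out ((counter n K τ b).run x n ω) -
          ∑ j ∈ Finset.range n, (x j : ℝ)| ≤ T / 2) := by
    intro x hx
    refine (hacc x hx).trans (Finset.sum_le_sum fun ω _ => ?_)
    have := min_le_left T (2 * n)
    split_ifs with h1 h2
    · exact le_rfl
    · exact absurd (h1.trans (by linarith)) h2
    · exact (isPMF_unif _).nonneg ω
    · exact le_rfl
  refine ⟨_, inferInstance, _, isPMF_unif (Fin n → Seed (τ + K)), counter n K τ b, hacc', ?_, ?_⟩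
  · intro D hD
    have hsq : ∀ y : Fin n → Fin 3, ∑ ω, unif (Fin n → Seed (τ + K)) ω *
        ((counter n K τ b).out ((counter n K τ b).run (ext3 n y) n ω) -
          ∑ j ∈ Finset.range n, (ext3 n y j : ℝ)) ^ 2 ≤ γ ^ 2 * n := by
      intro y
      have hy : ∀ j < n, ext3 n y j = -1 ∨ ext3 n y j = 0 ∨ ext3 n y j = 1 :=
        fun j _ => ext3_mem y j
      refine (sum_sq_le (isPMF_unif _) (hacc' _ hy)
        fun ω => counter_abs_out_sub_le hy _).trans ?_
      have h1 : (2 * (n : ℝ)) ^ 2 * (1 / (n : ℝ) ^ 3) = 4 / n := by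
        field_simp
        norm_num
      have h2 : 4 / (n : ℝ) ≤ 1 := (div_le_one hn0).2 hnR
      rw [h1, ← hT2]
      nlinarith
    calc _ ≤ ∑ y, D y * (γ ^ 2 * n) :=
          Finset.sum_le_sum fun y _ => mul_le_mul_of_nonneg_left (hsq y) (hD.nonneg y)
      _ = γ ^ 2 * n := by rw [← Finset.sum_mul, hD.sum_one, one_mul]
  · intro D hD hDB j hj
    rcases le_total T (2 * n) with h | h
    · rw [min_eq_left h] at hent
      exact hent B hB.le D hD hDB j hj
    · rw [min_eq_right h] at hent
      refine (hent (2 * n) le_rfl D hD ?_ j hj).trans ?_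
      · calc _ ≤ ∑ y, D y * (2 * n : ℝ) := by
              refine Finset.sum_le_sum fun y _ => mul_le_mul_of_nonneg_left ?_ (hD.nonneg y)
              have := Finset.card_le_univ (Finset.univ.filter fun j : Fin n => ext3 n y j.1 ≠ 0)
              rw [Fintype.card_fin] at this
              have : ((Finset.univ.filter fun j : Fin n => ext3 n y j.1 ≠ 0).card : ℝ) ≤ n := by
                exact_mod_cast this
              linarith
          _ = 2 * n := by rw [← Finset.sum_mul, hD.sum_one, one_mul]
      · have h1 : 0 ≤ Real.logb 2 (B / T) :=
          Real.logb_nonneg one_lt_two ((one_le_div (by linarith)).2 hB.le)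
        rw [div_self (by positivity), Real.logb_one]
        linarith

end ApproxSum
end
end
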